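/- arXiv:2603.15190 — 4 statements merged into one kernel-verified Lean document; each statement's English description precedes it below -/
import Mathlib

section
/- Gilbert–Varshamov-type construction of balanced ℓ1 codes: Fix real numbers α > 0, δ ∈ (0,1), ε > 0, and η > 0. Define R_GV(δ,α) = (1+α)·h₂(1/(1+α)) − (α/(1+α)+δ)·h₂(α/(α+(1+α)δ)) − (α+δ)·h₂(α/(α+δ)). Then there exists N₀ such that for every integer N ≥ N₀ there is a subset C ⊆ S_{⌊αN⌋,N} with the following four properties: (1) |C| ≥ 2^{N·(R_GV(δ,α) − η)}; (2) for all distinct x, y ∈ C, (1/2)∑_i |x_i − y_i| ≥ ⌊δN⌋; (3) every x ∈ C satisfies | |supp(x)|/N − α/(1+α) | ≤ η; (4) every x ∈ C satisfies max_i x_i ≤ (1+ε)·log_{1+α} N. -/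
open scoped BigOperators

/-- The discrete simplex `S_{q,N}`: q-tuples of nonnegative integers summing to `N`. -/
def simplex (q N : ℕ) : Finset (Fin q → ℕ) := Finset.Nat.antidiagonalTuple q N

/-- The base-2 binary entropy function. -/
noncomputable def binEnt (p : ℝ) : ℝ := -p * Real.logb 2 p - (1 - p) * Real.logb 2 (1 - p)

/-- The Gilbert–Varshamov-type exponent for balanced ℓ1 codes on the simplex. -/
noncomputable def RGV (δ α : ℝ) : ℝ :=
  (1 + α) * binEnt (1 / (1 + α))
    - (α / (1 + α) + δ) * binEnt (α / (α + (1 + α) * δ))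
    - (α + δ) * binEnt (α / (α + δ))

open Finset Filter Topology

/-- Greedy packing: a finite set all of whose neighbourhoods under a symmetric relation have at
most `B` elements contains a pairwise unrelated subset of proportion at least `1 / B`. -/
theorem exists_packing {ι : Type*} [DecidableEq ι] (r : ι → ι → Prop) [DecidableRel r]
    (hsymm : ∀ x y, r x y → r y x) (B : ℕ) (T : Finset ι)
    (hB : ∀ x ∈ T, #{y ∈ T | y = x ∨ r x y} ≤ B) :
    ∃ C ⊆ T, #T ≤ #C * B ∧ ∀ x ∈ C, ∀ y ∈ C, x ≠ y → ¬ r x y := by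
  induction T using Finset.strongInduction with
  | H T ih =>
    rcases T.eq_empty_or_nonempty with rfl | ⟨x, hx⟩
    · exact ⟨∅, by simp⟩
    · set T' := {y ∈ T | ¬ (y = x ∨ r x y)} with hT'
      have hsub : T' ⊂ T := by
        refine (Finset.filter_ssubset).2 ⟨x, hx, by simp⟩
      obtain ⟨C, hCT, hcard, hC⟩ := ih T' hsub fun z hz =>
        (Finset.card_le_card (Finset.filter_subset_filter _ hsub.subset)).trans
          (hB z (hsub.subset hz))
      have hxC : x ∉ C := fun h => by
        have := hCT h
        simp [hT'] at this
      refine ⟨insert x C, ?_, ?_, ?_⟩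
      · exact Finset.insert_subset hx (hCT.trans hsub.subset)
      · rw [Finset.card_insert_of_notMem hxC, ← Finset.card_filter_add_card_filter_not
          (s := T) (fun y => y = x ∨ r x y)]
        have := hB x hx
        rw [← hT', add_mul, one_mul]
        omega
      · have key : ∀ y ∈ C, ¬ r x y := fun y hy h => by
          have := hCT hy
          simp only [hT', Finset.mem_filter] at this
          tauto
        intro y hy z hz hyz
        rw [Finset.mem_insert] at hy hz
        rcases hy with rfl | hy <;> rcases hz with rfl | hz
        · exact absurd rfl hyz
        · exact key z hz
        · exact fun h => key y hy (hsymm _ _ h)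
        · exact hC y hy z hz hyz

theorem choose_sub_add_le (ρ : ℝ) (hρ1 : ρ ≤ 1) (n k : ℕ)
    (h : (n : ℝ) ≤ ρ * (n + k)) (m : ℕ) (hm : m ≤ n) (hρ : 0 ≤ ρ) :
    ((n - m + k).choose k : ℝ) ≤ ρ ^ m * ((n + k).choose k : ℝ) := by
  induction m with
  | zero => simp
  | succ m ih =>
    refine le_trans ?_ ((mul_le_mul_of_nonneg_left (ih (by omega)) hρ).trans_eq (by ring))
    obtain ⟨j, hj⟩ : ∃ j, n - m = j + 1 := ⟨n - m - 1, by omega⟩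
    have e1 : n - (m + 1) = j := by omega
    rw [hj, e1]
    have e := Nat.choose_mul_succ_eq (j + k) k
    have e2 : j + k + 1 - k = j + 1 := by omega
    rw [e2] at e
    have e' : ((j + k).choose k : ℝ) * (j + k + 1) = (j + 1 + k).choose k * (j + 1) := by
      rw [show j + 1 + k = j + k + 1 by ring]; exact_mod_cast e
    have hle : (j + 1 : ℝ) ≤ ρ * (j + k + 1) := by
      have hn : (n : ℝ) = j + 1 + m := by
        have : n = j + 1 + m := by omega
        exact_mod_cast this
      rw [hn] at h
      have : ρ * m ≤ m := mul_le_of_le_one_left (by positivity) hρ1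
      nlinarith
    have hpos : (0 : ℝ) < j + k + 1 := by positivity
    have := mul_le_mul_of_nonneg_left hle
      (show (0 : ℝ) ≤ ((j + 1 + k).choose k : ℝ) by positivity)
    refine le_of_mul_le_mul_right ?_ hpos
    linarith

theorem card_piAntidiag_nat {ι : Type*} [DecidableEq ι] (U : Finset ι) (n : ℕ) :
    #(piAntidiag U n) = (#U + n - 1).choose n := by
  rw [← card_finsuppAntidiag_nat_eq_choose]
  symm
  refine Finset.card_bij (fun f _ => ⇑f) ?_ (fun f _ g _ h => DFunLike.coe_injective h) ?_
  · intro f hf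
    rw [mem_finsuppAntidiag] at hf
    exact mem_piAntidiag.2 ⟨hf.1, fun i hi => hf.2 (Finsupp.mem_support_iff.2 hi)⟩
  · intro g hg
    rw [mem_piAntidiag] at hg
    exact ⟨Finsupp.onFinset U g hg.2, mem_finsuppAntidiag.2
      ⟨hg.1, Finsupp.support_onFinset_subset⟩, rfl⟩

/-- Among the tuples of sum `n` supported on `U`, those with some coordinate `≥ m` are few. -/
theorem card_piAntidiag_filter_lt {ι : Type*} [DecidableEq ι] (U : Finset ι) (n k m : ℕ)
    (hU : #U = k + 1) (ρ : ℝ) (hρ : 0 ≤ ρ) (hρ1 : ρ ≤ 1) (h : (n : ℝ) ≤ ρ * (n + k))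
    (hsmall : (k + 1) * ρ ^ m ≤ 1 / 2) :
    ((n + k).choose k : ℝ) / 2 ≤ #{y ∈ piAntidiag U n | ∀ i ∈ U, y i < m} := by
  have htot : #(piAntidiag U n) = (n + k).choose k := by
    rw [card_piAntidiag_nat, hU, show k + 1 + n - 1 = n + k by omega,
      Nat.choose_symm_add]
  have hbad : ∀ i ∈ U, (#{y ∈ piAntidiag U n | m ≤ y i} : ℝ) ≤
      ρ ^ m * ((n + k).choose k : ℝ) := by
    intro i hi
    by_cases hm : m ≤ n
    · refine le_trans ?_ (choose_sub_add_le ρ hρ1 n k h m hm hρ)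
      have hc : #(piAntidiag U (n - m)) = (n - m + k).choose k := by
        rw [card_piAntidiag_nat, hU, show k + 1 + (n - m) - 1 = n - m + k by omega,
          Nat.choose_symm_add]
      rw [← hc]
      norm_cast
      refine Finset.card_le_card_of_injOn (fun y => y - Pi.single i m) ?_ ?_
      · intro y hy
        simp only [Finset.coe_filter, Set.mem_ofPred_eq, mem_piAntidiag, SetLike.mem_coe] at hy ⊢
        obtain ⟨⟨hs, hsupp⟩, hmi⟩ := hy
        refine ⟨?_, ?_⟩
        · have hadd : U.sum y = U.sum (y - Pi.single i m) + m := by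
            have h1 : U.sum (Pi.single i m : ι → ℕ) = m := by
              simp [Finset.sum_pi_single', hi]
            refine Eq.trans ?_ (congrArg (U.sum (y - Pi.single i m) + ·) h1)
            rw [← Finset.sum_add_distrib]
            refine Finset.sum_congr rfl fun j _ => ?_
            by_cases hji : j = i
            · subst hji; simp; omega
            · simp [hji]
          change U.sum (y - Pi.single i m) = n - m
          omega
        · intro j hj
          refine hsupp j fun h0 => hj ?_
          simp [h0]
      · intro y hy z hz hyz
        simp only [Finset.coe_filter, Set.mem_ofPred_eq] at hy hz
        funext j
        have := congrFun hyz j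
        by_cases hji : j = i
        · subst hji; simp at this; omega
        · simpa [hji] using this
    · rw [Finset.filter_false_of_mem]
      · simp; positivity
      · intro y hy hmy
        rw [mem_piAntidiag] at hy
        have := Finset.single_le_sum (f := y) (fun _ _ => Nat.zero_le _) hi
        exact hm (hy.1 ▸ hmy.trans this)
  classical
  have hcover : piAntidiag U n ⊆ {y ∈ piAntidiag U n | ∀ i ∈ U, y i < m} ∪
      U.biUnion fun i => {y ∈ piAntidiag U n | m ≤ y i} := by
    intro y hy
    simp only [Finset.mem_union, Finset.mem_filter, Finset.mem_biUnion, hy, true_and]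
    by_contra! hcon
    obtain ⟨⟨i, hi, hi'⟩, h2⟩ := hcon
    have := h2 i hi
    omega
  have h1 := (Finset.card_le_card hcover).trans (Finset.card_union_le _ _)
  have h2 := h1.trans (Nat.add_le_add_left Finset.card_biUnion_le _)
  rw [htot] at h2
  have h3 : ((n + k).choose k : ℝ) ≤ #{y ∈ piAntidiag U n | ∀ i ∈ U, y i < m} +
      ∑ i ∈ U, (#{y ∈ piAntidiag U n | m ≤ y i} : ℝ) := by exact_mod_cast h2
  have h4 := Finset.sum_le_sum hbad
  rw [Finset.sum_const, hU, nsmul_eq_mul] at h4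
  push_cast at h4
  have h5 := mul_le_mul_of_nonneg_right hsmall
    (show (0 : ℝ) ≤ ((n + k).choose k : ℝ) by positivity)
  linarith

/-- Number of tuples in the simplex with exactly `k + 1` nonzero coordinates, all at most `m`. -/
theorem card_simplex_filter_ge (q n k m : ℕ) (ρ : ℝ) (hρ : 0 ≤ ρ) (hρ1 : ρ ≤ 1)
    (h : (n : ℝ) ≤ ρ * (n + k)) (hsmall : (k + 1) * ρ ^ m ≤ 1 / 2) :
    (q.choose (k + 1) : ℝ) * (((n + k).choose k : ℝ) / 2) ≤
      #{x ∈ simplex q (n + k + 1) | #{i | x i ≠ 0} = k + 1 ∧ ∀ i, x i ≤ m} := by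
  set F : Finset (Fin q) → Finset (Fin q → ℕ) :=
    fun U => {y ∈ piAntidiag U n | ∀ i ∈ U, y i < m} with hF
  have hle : #((powersetCard (k + 1) (univ : Finset (Fin q))).sigma F) ≤
      #{x ∈ simplex q (n + k + 1) | #{i | x i ≠ 0} = k + 1 ∧ ∀ i, x i ≤ m} := by
    have hsupp : ∀ U : Finset (Fin q), ∀ y ∈ F U,
        ({i | (y i + if i ∈ U then 1 else 0) ≠ 0} : Finset (Fin q)) = U := by
      intro U y hy
      simp only [hF, Finset.mem_filter, mem_piAntidiag] at hy
      ext i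
      by_cases hi : i ∈ U
      · simp [hi]
      · have : y i = 0 := by by_contra h0; exact hi (hy.1.2 i h0)
        simp [hi, this]
    refine Finset.card_le_card_of_injOn (fun p i => p.2 i + if i ∈ p.1 then 1 else 0) ?_ ?_
    · rintro ⟨U, y⟩ hp
      simp only [Finset.coe_sigma, Set.mem_sigma_iff, Finset.mem_coe, mem_powersetCard] at hp
      obtain ⟨⟨-, hU⟩, hy⟩ := hp
      have hs := hsupp U y hy
      simp only [hF, Finset.mem_filter, mem_piAntidiag] at hy
      have hz : ∀ i, i ∉ U → y i = 0 := fun i hi => by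
        by_contra h0; exact hi (hy.1.2 i h0)
      simp only [Finset.coe_filter, Set.mem_ofPred_eq, simplex,
        Finset.Nat.mem_antidiagonalTuple]
      refine ⟨?_, ?_, ?_⟩
      · rw [Finset.sum_add_distrib, ← Finset.sum_subset (Finset.subset_univ U)
          (fun i _ hi => hz i hi), hy.1.1]
        simp [hU]; ring
      · rw [hs, hU]
      · intro i
        by_cases hi : i ∈ U
        · have := hy.2 i hi
          simp [hi]; omega
        · simp [hi, hz i hi]
    · rintro ⟨U, y⟩ hp ⟨V, z⟩ hq heq
      simp only [Finset.coe_sigma, Set.mem_sigma_iff, Finset.mem_coe] at hp hq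
      have hUV : U = V := by
        rw [← hsupp U y hp.2, ← hsupp V z hq.2]
        ext i
        have hi : (y i + if i ∈ U then 1 else 0) = z i + if i ∈ V then 1 else 0 :=
          congrFun heq i
        rw [Finset.mem_filter, Finset.mem_filter, hi]
      subst hUV
      have : y = z := by
        funext i
        have := congrFun heq i
        simpa using this
      rw [this]
  refine le_trans ?_ (Nat.cast_le.2 hle)
  rw [Finset.card_sigma]
  push_cast
  have hsum := Finset.card_nsmul_le_sum (powersetCard (k + 1) (univ : Finset (Fin q)))
    (fun U => (#(F U) : ℝ)) (((n + k).choose k : ℝ) / 2)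
    (fun U hU => by
      convert! card_piAntidiag_filter_lt U n k m (mem_powersetCard.1 hU).2 ρ hρ hρ1 h hsmall)
  simpa [nsmul_eq_mul] using hsum

/-- Volume bound for `ℓ1` balls in the simplex. -/
theorem card_ball_le (q N s r : ℕ) (x : Fin q → ℕ) (hx : x ∈ simplex q N)
    (hs : #{i | x i ≠ 0} = s) (T : Finset (Fin q → ℕ)) (hT : T ⊆ simplex q N) :
    #{y ∈ T | ∑ i, (x i - y i) + ∑ i, (y i - x i) < 2 * r} ≤
      r * ((s + r).choose s * (q + r).choose q) := by
  set U : Finset (Fin q) := {i | x i ≠ 0} with hU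
  have hle : #{y ∈ T | ∑ i, (x i - y i) + ∑ i, (y i - x i) < 2 * r} ≤
      #((range r).biUnion fun j => piAntidiag U j ×ˢ piAntidiag (univ : Finset (Fin q)) j) := by
    refine Finset.card_le_card_of_injOn (fun y => (fun i => x i - y i, fun i => y i - x i)) ?_ ?_
    · intro y hy
      simp only [Finset.coe_filter, Set.mem_ofPred_eq] at hy
      obtain ⟨hyT, hd⟩ := hy
      have hy := hT hyT
      simp only [simplex, Finset.Nat.mem_antidiagonalTuple] at hx hy
      have hbal : ∑ i, (x i - y i) = ∑ i, (y i - x i) := by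
        have : ∑ i, (x i - y i) + ∑ i, y i = ∑ i, (y i - x i) + ∑ i, x i := by
          rw [← Finset.sum_add_distrib, ← Finset.sum_add_distrib]
          exact Finset.sum_congr rfl fun i _ => by omega
        omega
      simp only [Finset.coe_biUnion, Set.mem_iUnion, Finset.coe_product, Set.mem_prod,
        Finset.mem_coe, mem_piAntidiag]
      refine ⟨∑ i, (x i - y i), Finset.mem_range.2 (by omega), ⟨?_, ?_⟩, hbal.symm, by simp⟩
      · refine Finset.sum_subset (Finset.subset_univ U) fun i _ hi => ?_
        have : x i = 0 := by simpa [hU] using hi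
        simp [this]
      · intro i hi
        simp only [hU, Finset.mem_filter, Finset.mem_univ, true_and]
        omega
    · intro y _ z _ hyz
      simp only [Prod.mk.injEq] at hyz
      funext i
      have h1 := congrFun hyz.1 i
      have h2 := congrFun hyz.2 i
      omega
  have hch : ∀ a j, j < r → (a + j - 1).choose j ≤ (a + r).choose a := by
    intro a j hj
    calc (a + j - 1).choose j ≤ (a + j).choose j := Nat.choose_le_choose j (by omega)
      _ = (a + j).choose a := Nat.choose_symm_add.symm
      _ ≤ (a + r).choose a := Nat.choose_le_choose a (by omega)
  refine hle.trans (Finset.card_biUnion_le.trans ?_)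
  refine (Finset.sum_le_card_nsmul _ _ ((s + r).choose s * (q + r).choose q) ?_).trans_eq (by simp)
  intro j hj
  rw [Finset.card_product, card_piAntidiag_nat, card_piAntidiag_nat, hs,
    Finset.card_univ, Fintype.card_fin]
  exact Nat.mul_le_mul (hch s j (Finset.mem_range.1 hj)) (hch q j (Finset.mem_range.1 hj))

/-- Gilbert–Varshamov bound for the simplex, before taking asymptotics. -/
theorem exists_code (q n k m r : ℕ) (ρ : ℝ) (hρ : 0 ≤ ρ) (hρ1 : ρ ≤ 1)
    (h : (n : ℝ) ≤ ρ * (n + k)) (hsmall : (k + 1) * ρ ^ m ≤ 1 / 2) (hr : 0 < r) :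
    ∃ C ⊆ simplex q (n + k + 1),
      (q.choose (k + 1) : ℝ) * (((n + k).choose k : ℝ) / 2) ≤
        #C * (r * ((k + 1 + r).choose (k + 1) * (q + r).choose q)) ∧
      (∀ x ∈ C, ∀ y ∈ C, x ≠ y → (r : ℝ) ≤ (∑ i, |(x i : ℝ) - (y i : ℝ)|) / 2) ∧
      (∀ x ∈ C, #{i | x i ≠ 0} = k + 1) ∧ ∀ x ∈ C, ∀ i, x i ≤ m := by
  set T := {x ∈ simplex q (n + k + 1) | #{i | x i ≠ 0} = k + 1 ∧ ∀ i, x i ≤ m} with hT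
  obtain ⟨C, hCT, hcard, hC⟩ := exists_packing
    (fun x y : Fin q → ℕ => ∑ i, (x i - y i) + ∑ i, (y i - x i) < 2 * r)
    (fun x y hxy => by omega) (r * ((k + 1 + r).choose (k + 1) * (q + r).choose q)) T (by
      intro x hx
      have hx' := Finset.mem_filter.1 hx
      refine le_trans (Finset.card_le_card fun y hy => ?_)
        (card_ball_le q (n + k + 1) (k + 1) r x hx'.1 hx'.2.1 T (Finset.filter_subset _ _))
      rw [Finset.mem_filter] at hy ⊢
      refine ⟨hy.1, hy.2.elim (fun e => ?_) id⟩
      subst e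
      simpa using hr)
  refine ⟨C, hCT.trans (Finset.filter_subset _ _), ?_, ?_, ?_, ?_⟩
  · refine (card_simplex_filter_ge q n k m ρ hρ hρ1 h hsmall).trans ?_
    exact_mod_cast hcard
  · intro x hx y hy hxy
    have h1 := not_lt.1 (hC x hx y hy hxy)
    have h2 : ∑ i, |(x i : ℝ) - (y i : ℝ)| = ((∑ i, (x i - y i) + ∑ i, (y i - x i) : ℕ) : ℝ) := by
      push_cast [← Finset.sum_add_distrib]
      refine Finset.sum_congr rfl fun i _ => ?_
      rcases le_total (x i) (y i) with hi | hi
      · have : (x i : ℝ) ≤ y i := by exact_mod_cast hi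
        rw [abs_of_nonpos (by linarith), Nat.sub_eq_zero_of_le hi, Nat.cast_sub hi]
        simp
      · have : (y i : ℝ) ≤ x i := by exact_mod_cast hi
        rw [abs_of_nonneg (by linarith), Nat.sub_eq_zero_of_le hi, Nat.cast_sub hi]
        simp
    rw [h2]
    have h3 : ((2 * r : ℕ) : ℝ) ≤ ((∑ i, (x i - y i) + ∑ i, (y i - x i) : ℕ) : ℝ) := by
      exact_mod_cast h1
    push_cast at h3 ⊢
    linarith
  · exact fun x hx => (Finset.mem_filter.1 (hCT hx)).2.1
  · exact fun x hx => (Finset.mem_filter.1 (hCT hx)).2.2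

/-- Stirling's formula on the logarithmic scale. -/
theorem tendsto_log_factorial :
    Tendsto (fun n : ℕ => (Real.log n.factorial - n * Real.log n + n) / n) atTop (𝓝 0) := by
  have h1 : Tendsto (fun n : ℕ => Real.log (Stirling.stirlingSeq n) / n) atTop (𝓝 0) :=
    (Stirling.tendsto_stirlingSeq_sqrt_pi.log (by positivity)).div_atTop
      tendsto_natCast_atTop_atTop
  have h2 : Tendsto (fun n : ℕ => Real.log n / n) atTop (𝓝 0) :=
    (Real.isLittleO_log_id_atTop.tendsto_div_nhds_zero).comp tendsto_natCast_atTop_atTop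
  have h3 : Tendsto (fun n : ℕ => (1 / 2 * Real.log 2) / (n : ℝ)) atTop (𝓝 0) :=
    tendsto_const_nhds.div_atTop tendsto_natCast_atTop_atTop
  have h4 := (h1.add (h2.const_mul (1 / 2))).add h3
  simp only [mul_zero, add_zero] at h4
  refine h4.congr' ?_
  filter_upwards [eventually_gt_atTop 0] with n hn
  have hn' : (n : ℝ) ≠ 0 := by positivity
  rw [Stirling.log_stirlingSeq_formula, Real.log_mul two_ne_zero hn',
    Real.log_div hn' (Real.exp_ne_zero 1), Real.log_exp]
  ring

theorem tendsto_log_factorial_comp (f : ℕ → ℕ) (a : ℝ) (ha : 0 < a)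
    (hf : Tendsto (fun N : ℕ => (f N : ℝ) / N) atTop (𝓝 a)) :
    Tendsto (fun N : ℕ => (Real.log (f N).factorial - f N * Real.log N) / N) atTop
      (𝓝 (a * Real.log a - a)) := by
  have hinf : Tendsto f atTop atTop := by
    rw [← tendsto_natCast_atTop_iff (R := ℝ)]
    refine (hf.pos_mul_atTop ha tendsto_natCast_atTop_atTop).congr' ?_
    filter_upwards [eventually_gt_atTop 0] with N hN
    have : (N : ℝ) ≠ 0 := by positivity
    field_simp
  have h := (((tendsto_log_factorial.comp hinf).mul hf).add (hf.mul (hf.log ha.ne'))).sub hf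
  rw [zero_mul, zero_add] at h
  refine h.congr' ?_
  filter_upwards [eventually_gt_atTop 0, hinf.eventually_gt_atTop 0] with N hN hfN
  have h1 : (N : ℝ) ≠ 0 := by positivity
  have h2 : (f N : ℝ) ≠ 0 := by positivity
  simp only [Function.comp_apply]
  rw [Real.log_div h2 h1]
  field_simp
  ring

/-- Exponential growth rate of binomial coefficients. -/
theorem tendsto_log_choose (f g : ℕ → ℕ) (a b : ℝ) (hb : 0 < b) (hba : b < a)
    (hf : Tendsto (fun N : ℕ => (f N : ℝ) / N) atTop (𝓝 a))
    (hg : Tendsto (fun N : ℕ => (g N : ℝ) / N) atTop (𝓝 b)) (hgf : ∀ᶠ N in atTop, g N ≤ f N) :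
    Tendsto (fun N : ℕ => Real.log ((f N).choose (g N)) / N) atTop
      (𝓝 (a * Real.log a - b * Real.log b - (a - b) * Real.log (a - b))) := by
  have hfg : Tendsto (fun N : ℕ => ((f N - g N : ℕ) : ℝ) / N) atTop (𝓝 (a - b)) := by
    refine (hf.sub hg).congr' ?_
    filter_upwards [hgf] with N hN
    rw [Nat.cast_sub hN]
    ring
  have h := ((tendsto_log_factorial_comp f a (hb.trans hba) hf).sub
    (tendsto_log_factorial_comp g b hb hg)).sub
    (tendsto_log_factorial_comp _ (a - b) (sub_pos.2 hba) hfg)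
  convert! h.congr' ?_ using 2
  · ring
  · filter_upwards [hgf] with N hN
    have h1 := Nat.choose_mul_factorial_mul_factorial hN
    have h2 : Real.log (f N).factorial = Real.log ((f N).choose (g N)) +
        Real.log (g N).factorial + Real.log (f N - g N).factorial := by
      rw [← h1]
      have := (Nat.choose_pos hN).ne'
      have := (g N).factorial_ne_zero
      have := (f N - g N).factorial_ne_zero
      push_cast
      rw [Real.log_mul (by positivity) (by positivity),
        Real.log_mul (by positivity) (by positivity)]
    rw [h2, Nat.cast_sub hN]
    ring

theorem log_choose_le (x y N : ℝ) (hx : 0 < x) (hy : 0 < y) (s r : ℕ)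
    (hs : s ≤ x * N) (hr : r ≤ y * N) :
    Real.log ((s + r).choose s) ≤
      N * ((x + y) * Real.log (x + y) - x * Real.log x - y * Real.log y) := by
  have h1 : x ^ s * y ^ r * ((s + r).choose s : ℝ) ≤ (x + y) ^ (s + r) := by
    rw [add_pow]
    refine le_trans (le_of_eq ?_) (Finset.single_le_sum
      (f := fun j => x ^ j * y ^ (s + r - j) * ((s + r).choose j : ℝ))
      (fun j _ => by positivity) (Finset.mem_range.2 (show s < s + r + 1 by omega)))
    simp
  have hc : (0 : ℝ) < ((s + r).choose s : ℝ) := by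
    exact_mod_cast Nat.choose_pos (Nat.le_add_right s r)
  have h2 := Real.log_le_log (by positivity) h1
  rw [Real.log_mul (by positivity) hc.ne', Real.log_mul (by positivity) (by positivity),
    Real.log_pow, Real.log_pow, Real.log_pow] at h2
  push_cast at h2
  have hX : 0 ≤ Real.log (x + y) - Real.log x :=
    sub_nonneg.2 (Real.log_le_log hx (by linarith))
  have hY : 0 ≤ Real.log (x + y) - Real.log y :=
    sub_nonneg.2 (Real.log_le_log hy (by linarith))
  have h3 := mul_le_mul_of_nonneg_right hs hX
  have h4 := mul_le_mul_of_nonneg_right hr hY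
  linarith

theorem log_two_mul_binEnt (x y : ℝ) (hx : 0 < x) (hy : 0 < y) :
    Real.log 2 * ((x + y) * binEnt (x / (x + y))) =
      (x + y) * Real.log (x + y) - x * Real.log x - y * Real.log y := by
  have h2 : Real.log 2 ≠ 0 := (Real.log_pos one_lt_two).ne'
  have hxy : x + y ≠ 0 := by positivity
  have e : 1 - x / (x + y) = y / (x + y) := by field_simp; ring
  rw [binEnt, e, Real.logb, Real.logb, Real.log_div hx.ne' hxy, Real.log_div hy.ne' hxy]
  field_simp
  ring

theorem log_two_mul_RGV (α β δ : ℝ) (hα : 0 < α) (hδ : 0 < δ) (hβ : β = α / (1 + α)) :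
    Real.log 2 * RGV δ α =
      (α * Real.log α - β * Real.log β - (α - β) * Real.log (α - β)) +
      (1 * Real.log 1 - β * Real.log β - (1 - β) * Real.log (1 - β)) -
      ((β + δ) * Real.log (β + δ) - β * Real.log β - δ * Real.log δ) -
      ((α + δ) * Real.log (α + δ) - α * Real.log α - δ * Real.log δ) := by
  have h1α : (0 : ℝ) < 1 + α := by positivity
  have hβ0 : 0 < β := hβ ▸ by positivity
  have e1 : α / (α + (1 + α) * δ) = β / (β + δ) := by
    rw [hβ]; field_simp
  rw [← log_two_mul_binEnt β δ hβ0 hδ, ← log_two_mul_binEnt α δ hα hδ, RGV, e1, ← hβ]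
  have h := log_two_mul_binEnt 1 α one_pos hα
  have e2 : α - β = α ^ 2 / (1 + α) := by rw [hβ]; field_simp; ring
  have e3 : 1 - β = 1 / (1 + α) := by rw [hβ]; field_simp; ring
  have l1 : Real.log β = Real.log α - Real.log (1 + α) := by
    rw [hβ, Real.log_div hα.ne' h1α.ne']
  have l2 : Real.log (α - β) = 2 * Real.log α - Real.log (1 + α) := by
    rw [e2, Real.log_div (by positivity) h1α.ne', Real.log_pow]
    norm_num
  have l3 : Real.log (1 - β) = - Real.log (1 + α) := by
    rw [e3, Real.log_div one_ne_zero h1α.ne', Real.log_one, zero_sub]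
  rw [l1, l2, l3]
  simp only [Real.log_one] at h ⊢
  linarith

theorem eventually_mul_pow_floor_logb_le (α ε : ℝ) (hα : 0 < α) (hε : 0 < ε) :
    ∃ ρ : ℝ, 1 / (1 + α) < ρ ∧ ρ ≤ 1 ∧
      ∀ᶠ N : ℕ in atTop, (N : ℝ) * ρ ^ ⌊(1 + ε) * Real.logb (1 + α) N⌋₊ ≤ 1 / 2 := by
  have hL : 0 < Real.log (1 + α) := Real.log_pos (by linarith)
  set c := (1 + ε / 2) / (1 + ε) * Real.log (1 + α) with hc
  have hc0 : 0 < c := by positivity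
  refine ⟨Real.exp (-c), ?_, ?_, ?_⟩
  · have : 1 / (1 + α) = Real.exp (-Real.log (1 + α)) := by
      rw [Real.exp_neg, Real.exp_log (by positivity), one_div]
    rw [this, Real.exp_lt_exp, neg_lt_neg_iff, hc]
    refine mul_lt_of_lt_one_left hL ?_
    rw [div_lt_one (by positivity)]
    linarith
  · rw [Real.exp_le_one_iff]; linarith
  · have hlog : Tendsto (fun N : ℕ => Real.log (N : ℝ)) atTop atTop :=
      Real.tendsto_log_atTop.comp tendsto_natCast_atTop_atTop
    have h0 : Tendsto (fun N : ℕ => Real.exp (c - ε / 2 * Real.log N)) atTop (𝓝 0) := by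
      refine Real.tendsto_exp_atBot.comp ?_
      simp only [sub_eq_add_neg]
      exact tendsto_atBot_add_const_left _ _
        (tendsto_neg_atTop_atBot.comp (hlog.const_mul_atTop (by positivity)))
    filter_upwards [h0.eventually_le_const (show (0 : ℝ) < 1 / 2 by norm_num),
      eventually_gt_atTop 0] with N hN hN0
    refine le_trans ?_ hN
    have hN0' : (0 : ℝ) < N := by positivity
    set L := (1 + ε) * Real.logb (1 + α) N with hLdef
    have hfl : L - 1 ≤ ⌊L⌋₊ := by linarith [Nat.lt_floor_add_one L]
    have hcL : c * L = (1 + ε / 2) * Real.log N := by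
      rw [hc, hLdef, Real.logb]
      field_simp
    calc (N : ℝ) * Real.exp (-c) ^ ⌊L⌋₊
        = Real.exp (Real.log N + ⌊L⌋₊ * (-c)) := by
          rw [Real.exp_add, Real.exp_log hN0', Real.exp_nat_mul]
      _ ≤ Real.exp (c - ε / 2 * Real.log N) := by
          rw [Real.exp_le_exp]
          nlinarith [mul_le_mul_of_nonneg_left hfl hc0.le]

/-- GV-construction of balanced ℓ1 codes: for all large `N` there is a code
`C ⊆ S_{⌊αN⌋,N}` of size at least `2^{N(R_GV(δ,α)-η)}`, ℓ1-distance at least `⌊δN⌋`,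
normalized support size within `η` of `α/(1+α)`, and max coordinate at most
`(1+ε) log_{1+α} N`. -/
theorem gv_balanced_ell1_codes (α δ ε η : ℝ)
    (hα : 0 < α) (hδ0 : 0 < δ) (hδ1 : δ < 1) (hε : 0 < ε) (hη : 0 < η) :
    ∃ N₀ : ℕ, ∀ N : ℕ, N₀ ≤ N →
      ∃ C : Finset (Fin ⌊α * (N : ℝ)⌋₊ → ℕ),
        C ⊆ simplex ⌊α * (N : ℝ)⌋₊ N ∧
        (2 : ℝ) ^ ((N : ℝ) * (RGV δ α - η)) ≤ (C.card : ℝ) ∧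
        (∀ x ∈ C, ∀ y ∈ C, x ≠ y →
          ((⌊δ * (N : ℝ)⌋₊ : ℝ)) ≤ (∑ i, |(x i : ℝ) - (y i : ℝ)|) / 2) ∧
        (∀ x ∈ C,
          |((Finset.univ.filter fun i => x i ≠ 0).card : ℝ) / (N : ℝ) - α / (1 + α)| ≤ η) ∧
        (∀ x ∈ C, ∀ i, (x i : ℝ) ≤ (1 + ε) * Real.logb (1 + α) (N : ℝ)) := by
  obtain ⟨ρ, hρα, hρ1, hρ⟩ := eventually_mul_pow_floor_logb_le α ε hα hε
  set β := α / (1 + α) with hβ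
  have hβ0 : 0 < β := by positivity
  have hβ1 : β < 1 := by rw [hβ, div_lt_one (by positivity)]; linarith
  have hβα : β < α := by
    rw [hβ]; exact div_lt_self hα (by linarith)
  have hρ0 : 0 ≤ ρ := le_trans (by positivity) hρα.le
  have h1β : 1 - β = 1 / (1 + α) := by rw [hβ]; field_simp; ring
  have hcast : Tendsto (fun N : ℕ => (N : ℝ)) atTop atTop := tendsto_natCast_atTop_atTop
  have hfloor : ∀ a : ℝ, 0 ≤ a → Tendsto (fun N : ℕ => (⌊a * (N : ℝ)⌋₊ : ℝ) / N) atTop (𝓝 a) :=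
    fun a ha => (tendsto_nat_floor_mul_div_atTop ha).comp hcast
  have hpos : ∀ a : ℝ, 0 < a → ∀ᶠ N : ℕ in atTop, 0 < ⌊a * (N : ℝ)⌋₊ := fun a ha =>
    (tendsto_nat_floor_atTop.comp (hcast.const_mul_atTop ha)).eventually_gt_atTop 0
  have hle : ∀ N : ℕ, ⌊β * (N : ℝ)⌋₊ ≤ N := fun N => by
    refine Nat.floor_le_of_le ?_
    exact mul_le_of_le_one_left (Nat.cast_nonneg N) hβ1.le
  have hinv : Tendsto (fun N : ℕ => (1 : ℝ) / N) atTop (𝓝 0) :=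
    tendsto_const_nhds.div_atTop hcast
  have hpred1 : Tendsto (fun N : ℕ => ((N - 1 : ℕ) : ℝ) / N) atTop (𝓝 1) := by
    have := hinv.const_sub 1
    rw [sub_zero] at this
    refine this.congr' ?_
    filter_upwards [eventually_gt_atTop 0] with N hN
    rw [Nat.cast_sub hN]
    field_simp
    simp
  have hpredβ : Tendsto (fun N : ℕ => ((⌊β * (N : ℝ)⌋₊ - 1 : ℕ) : ℝ) / N) atTop (𝓝 β) := by
    have := (hfloor β hβ0.le).sub hinv
    rw [sub_zero] at this
    refine this.congr' ?_
    filter_upwards [hpos β hβ0] with N hN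
    rw [Nat.cast_sub hN]
    push_cast
    ring
  have hc1 := tendsto_log_choose (fun N => ⌊α * (N : ℝ)⌋₊) (fun N => ⌊β * (N : ℝ)⌋₊) α β hβ0 hβα
    (hfloor α hα.le) (hfloor β hβ0.le) (Eventually.of_forall fun N => by
      gcongr)
  have hc2 := tendsto_log_choose (fun N => N - 1) (fun N => ⌊β * (N : ℝ)⌋₊ - 1) 1 β hβ0 hβ1
    hpred1 hpredβ (Eventually.of_forall fun N => Nat.sub_le_sub_right (hle N) 1)
  have hlogN : Tendsto (fun N : ℕ => Real.log N / N) atTop (𝓝 0) :=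
    (Real.isLittleO_log_id_atTop.tendsto_div_nhds_zero).comp hcast
  have hlog2 : Tendsto (fun N : ℕ => Real.log 2 / (N : ℝ)) atTop (𝓝 0) :=
    tendsto_const_nhds.div_atTop hcast
  have hmain := ((hc1.add hc2).sub hlog2).sub hlogN
  simp only [sub_zero] at hmain
  have hRGV := log_two_mul_RGV α β δ hα hδ0 hβ
  have hl2 : 0 < Real.log 2 := Real.log_pos one_lt_two
  have hrate := hmain.eventually_const_le (sub_lt_self _ (mul_pos hl2 hη))
  have hratio : ∀ᶠ N : ℕ in atTop,
      (N - ⌊β * (N : ℝ)⌋₊ : ℝ) / N ≤ ρ * (((N - 1 : ℕ) : ℝ) / N) := by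
    have hlim : Tendsto (fun N : ℕ => (N - ⌊β * (N : ℝ)⌋₊ : ℝ) / N) atTop (𝓝 (1 - β)) := by
      refine ((hfloor β hβ0.le).const_sub 1).congr' ?_
      filter_upwards [eventually_gt_atTop 0] with N hN
      field_simp
    have hlt : 1 - β < ρ * 1 := by rw [h1β]; linarith
    filter_upwards [hlim.eventually_lt (hpred1.const_mul ρ) hlt] with N hN
    exact hN.le
  have hsupp : ∀ᶠ N : ℕ in atTop, |(⌊β * (N : ℝ)⌋₊ : ℝ) / N - β| ≤ η := by
    filter_upwards [Metric.tendsto_nhds.1 (hfloor β hβ0.le) η hη] with N hN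
    exact hN.le
  have hall := hrate.and (hratio.and (hsupp.and (hρ.and ((hpos β hβ0).and
    ((hpos δ hδ0).and (eventually_gt_atTop 0))))))
  obtain ⟨N₀, hN₀⟩ := eventually_atTop.1 hall
  refine ⟨N₀, fun N hN => ?_⟩
  obtain ⟨hrate, hratio, hsupp, hρ, hs, hr, hN0⟩ := hN₀ N hN
  have hNpos : (0 : ℝ) < N := by positivity
  set s := ⌊β * (N : ℝ)⌋₊ with hsdef
  set r := ⌊δ * (N : ℝ)⌋₊ with hrdef
  set q := ⌊α * (N : ℝ)⌋₊ with hqdef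
  set L := (1 + ε) * Real.logb (1 + α) (N : ℝ) with hLdef
  have hsN : s ≤ N := hle N
  have hsx : (s : ℝ) ≤ β * N := Nat.floor_le (by positivity)
  have hrx : (r : ℝ) ≤ δ * N := Nat.floor_le (by positivity)
  have hqx : (q : ℝ) ≤ α * N := Nat.floor_le (by positivity)
  have hsq : s ≤ q := by rw [hsdef, hqdef]; gcongr
  have e1 : N - s + (s - 1) = N - 1 := by omega
  have e2 : s - 1 + 1 = s := by omega
  have e3 : N - s + (s - 1) + 1 = N := by omega
  have e2' : ((s - 1 : ℕ) : ℝ) + 1 = s := by exact_mod_cast e2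
  obtain ⟨C, hCsub, hcard, hdist, hCsupp, hmax⟩ := exists_code q (N - s) (s - 1) ⌊L⌋₊ r ρ hρ0 hρ1
    (by
      have : ((N - s : ℕ) : ℝ) + ((s - 1 : ℕ) : ℝ) = ((N - 1 : ℕ) : ℝ) := by exact_mod_cast e1
      rw [this, Nat.cast_sub hsN]
      rwa [← mul_div_assoc, div_le_div_iff_of_pos_right hNpos] at hratio)
    (by
      rw [e2']
      refine le_trans ?_ hρ
      gcongr) hr
  rw [e3] at hCsub
  rw [e1, e2] at hcard
  refine ⟨C, hCsub, ?_, hdist, ?_, ?_⟩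
  · have hp1 : (0 : ℝ) < q.choose s := by exact_mod_cast Nat.choose_pos hsq
    have hp2 : (0 : ℝ) < (N - 1).choose (s - 1) := by
      exact_mod_cast Nat.choose_pos (Nat.sub_le_sub_right hsN 1)
    have hp3 : (0 : ℝ) < (s + r).choose s := by
      exact_mod_cast Nat.choose_pos (Nat.le_add_right s r)
    have hp4 : (0 : ℝ) < (q + r).choose q := by
      exact_mod_cast Nat.choose_pos (Nat.le_add_right q r)
    have hrpos : (0 : ℝ) < r := by exact_mod_cast hr
    have hC0 : (0 : ℝ) < #C := by
      refine pos_of_mul_pos_left (lt_of_lt_of_le ?_ hcard) (by positivity)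
      positivity
    have hlog := Real.log_le_log (by positivity) hcard
    rw [Real.log_mul hp1.ne' (by positivity), Real.log_div hp2.ne' two_ne_zero,
      Real.log_mul hC0.ne' (by positivity), Real.log_mul hrpos.ne' (by positivity),
      Real.log_mul hp3.ne' hp4.ne'] at hlog
    have hrN : Real.log r ≤ Real.log N := by
      refine Real.log_le_log hrpos (hrx.trans ?_)
      exact mul_le_of_le_one_left hNpos.le hδ1.le
    have hu1 := log_choose_le β δ N hβ0 hδ0 s r hsx hrx
    have hu2 := log_choose_le α δ N hα hδ0 q r hqx hrx
    have hrate' := mul_le_mul_of_nonneg_left hrate hNpos.le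
    have e4 : (N : ℝ) * (Real.log (q.choose s) / N + Real.log ((N - 1).choose (s - 1)) / N -
        Real.log 2 / N - Real.log N / N) =
        Real.log (q.choose s) + Real.log ((N - 1).choose (s - 1)) - Real.log 2 - Real.log N := by
      field_simp
    rw [e4] at hrate'
    rw [Real.rpow_def_of_pos two_pos, ← Real.le_log_iff_exp_le hC0]
    have e5 : Real.log 2 * ((N : ℝ) * (RGV δ α - η)) =
      N * (Real.log 2 * RGV δ α) - N * (Real.log 2 * η) := by ring
    rw [e5, hRGV]
    linarith
  · intro x hx
    rw [hCsupp x hx, e2]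
    exact hsupp
  · intro x hx i
    have hpos' : 0 ≤ L := by
      refine mul_nonneg (by positivity) (Real.logb_nonneg (by linarith) ?_)
      exact_mod_cast hN0
    exact le_trans (Nat.cast_le.2 (hmax x hx i)) (Nat.floor_le hpos')
end

section
/- Uniform random ℓ1 codes are asymptotically good: Fix real numbers α > 0, δ ∈ (0,1) and ε > 0, and define R_U(δ,α) = ((1+α)/2)·h₂(1/(1+α)) − (α+δ)·h₂(α/(α+δ)). Let (L_N)_{N} be a sequence of positive integers such that L_N ≤ 2^{N·(R_U(δ,α)−ε)} for all sufficiently large N. For each N, let X₁,…,X_{L_N} be independent random vectors, each distributed uniformly on the discrete simplex S_{⌊αN⌋,N}. Then the probability of the event {for all i ≠ j, (1/2)∑_k |X_i(k) − X_j(k)| ≥ ⌊δN⌋} tends to 1 as N → ∞. -/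
open scoped BigOperators Classical

/-- The rate exponent for uniform random ℓ1 codes. -/
noncomputable def RU (δ α : ℝ) : ℝ :=
  ((1 + α) / 2) * binEnt (1 / (1 + α)) - (α + δ) * binEnt (α / (α + δ))

theorem mem_simplex {q N : ℕ} {x : Fin q → ℕ} : x ∈ simplex q N ↔ ∑ i, x i = N :=
  Finset.Nat.mem_antidiagonalTuple

theorem card_simplex (q N : ℕ) : (simplex q N).card = (q + N - 1).choose N := by
  have h : Fintype.card (simplex q N) = Fintype.card (Sym (Fin q) N) :=
    Fintype.card_congr
      ((Equiv.subtypeEquivRight fun _ => mem_simplex).trans (Sym.equivNatSumOfFintype _ _).symm)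
  rw [Fintype.card_coe, Sym.card_sym_eq_choose, Fintype.card_fin] at h
  exact h

theorem card_simplex_succ (m N : ℕ) : (simplex (m + 1) N).card = (m + N).choose m := by
  rw [card_simplex, show m + 1 + N - 1 = m + N by omega, Nat.choose_symm_add]

theorem binEnt_mul_log_two (p : ℝ) :
    binEnt p * Real.log 2 = -p * Real.log p - (1 - p) * Real.log (1 - p) := by
  have : Real.log 2 ≠ 0 := (Real.log_pos one_lt_two).ne'
  unfold binEnt Real.logb
  field_simp

theorem choose_mul_pow_mul_pow_le_one {p : ℝ} (hp0 : 0 ≤ p) (hp1 : p ≤ 1) (a b : ℕ) :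
    ((a + b).choose a : ℝ) * (p ^ a * (1 - p) ^ b) ≤ 1 := by
  have hp : 0 ≤ 1 - p := sub_nonneg.2 hp1
  have h := add_pow p (1 - p) (a + b)
  rw [add_sub_cancel, one_pow] at h
  calc _ = p ^ a * (1 - p) ^ (a + b - a) * ((a + b).choose a : ℝ) := by
        rw [Nat.add_sub_cancel_left]; ring
    _ ≤ ∑ k ∈ Finset.range (a + b + 1), p ^ k * (1 - p) ^ (a + b - k) * ((a + b).choose k : ℝ) :=
        Finset.single_le_sum
          (f := fun k => p ^ k * (1 - p) ^ (a + b - k) * ((a + b).choose k : ℝ))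
          (fun k _ => by positivity) (Finset.mem_range.2 (by omega))
    _ = 1 := h.symm

/-- The entropy bound for binomial coefficients, relaxed to real upper bounds for `a` and `b`. -/
theorem choose_le_two_rpow_binEnt {A B : ℝ} (hA : 0 < A) (hB : 0 < B) {a b : ℕ}
    (ha : a ≤ A) (hb : b ≤ B) :
    ((a + b).choose a : ℝ) ≤ (2 : ℝ) ^ ((A + B) * binEnt (A / (A + B))) := by
  have hAB : 0 < A + B := add_pos hA hB
  set p := A / (A + B) with hp
  have hq : 1 - p = B / (A + B) := by rw [hp]; field_simp; ring
  have hp0 : 0 < p := div_pos hA hAB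
  have hq0 : 0 < 1 - p := hq ▸ div_pos hB hAB
  have hC : (0 : ℝ) < ((a + b).choose a : ℝ) := by
    exact_mod_cast Nat.choose_pos (Nat.le_add_right a b)
  rw [← Real.log_le_log_iff hC (by positivity), Real.log_rpow two_pos, mul_assoc,
    binEnt_mul_log_two]
  have h := Real.log_le_log (by positivity)
    (choose_mul_pow_mul_pow_le_one hp0.le (sub_pos.1 hq0).le a b)
  rw [Real.log_one, Real.log_mul hC.ne' (by positivity), Real.log_mul (by positivity)
    (by positivity), Real.log_pow, Real.log_pow] at h
  have h1 : Real.log p ≤ 0 := Real.log_nonpos hp0.le (sub_pos.1 hq0).le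
  have h2 : Real.log (1 - p) ≤ 0 := Real.log_nonpos hq0.le (by linarith)
  have h3 : (A + B) * p = A := by rw [hp]; field_simp
  have h4 : (A + B) * (1 - p) = B := by rw [hq]; field_simp
  calc _ ≤ -(a * Real.log p) - b * Real.log (1 - p) := by linarith
    _ ≤ -(A * Real.log p) - B * Real.log (1 - p) := by
      nlinarith [mul_le_mul_of_nonpos_right ha h1, mul_le_mul_of_nonpos_right hb h2]
    _ = -((A + B) * p * Real.log p) - (A + B) * (1 - p) * Real.log (1 - p) := by rw [h3, h4]
    _ = _ := by ring

theorem log_factorial_le {n : ℕ} (hn : n ≠ 0) :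
    Real.log n.factorial ≤ n * Real.log n - n + Real.log n / 2 + 1 := by
  obtain ⟨k, rfl⟩ := Nat.exists_eq_succ_of_ne_zero hn
  have h := Stirling.log_stirlingSeq'_antitone (Nat.zero_le k)
  simp only [Function.comp_apply, Nat.succ_eq_add_one, zero_add, Stirling.stirlingSeq_one] at h
  rw [Stirling.log_stirlingSeq_formula, Real.log_div (by positivity) (Real.exp_pos 1).ne',
    Real.log_div (Real.exp_pos 1).ne' (by positivity), Real.log_exp,
    Real.log_sqrt (by positivity), Real.log_mul (by positivity) (by positivity)] at h
  push_cast at h ⊢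
  linarith

theorem le_log_choose {m N : ℕ} (hm : m ≠ 0) (hN : N ≠ 0) :
    ((m : ℝ) + N) * Real.log (m + N) - m * Real.log m - N * Real.log N
      - Real.log m / 2 - Real.log N / 2 - 2 ≤ Real.log ((m + N).choose m) := by
  have hC : ((m + N).choose m : ℝ) = (m + N).factorial / (m.factorial * N.factorial) := by
    rw [Nat.choose_symm_add, Nat.add_choose, Nat.cast_div (Nat.factorial_mul_factorial_dvd_factorial_add m N)
      (by positivity)]
    push_cast; rfl
  rw [hC, Real.log_div (by positivity) (by positivity), Real.log_mul (by positivity)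
    (by positivity)]
  have h := Stirling.le_log_factorial_stirling (n := m + N) (by omega)
  have h1 : 0 ≤ Real.log ((m + N : ℕ) : ℝ) :=
    Real.log_natCast_nonneg _
  have h2 : 0 ≤ Real.log (2 * Real.pi) := Real.log_nonneg (by nlinarith [Real.pi_gt_three])
  have h3 := log_factorial_le hm
  have h4 := log_factorial_le hN
  push_cast at h h1
  linarith

open Filter Topology in
/-- A lower bound for the size of the simplex, tight to first exponential order. -/
theorem eventually_two_rpow_le_card_simplex {α ε : ℝ} (hα : 0 < α) (hε : 0 < ε) :
    ∀ᶠ N : ℕ in atTop, (2 : ℝ) ^ ((N : ℝ) * ((1 + α) * binEnt (1 / (1 + α)) - ε)) ≤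
      ((simplex ⌊α * (N : ℝ)⌋₊ N).card : ℝ) := by
  have hG : (1 + α) * binEnt (1 / (1 + α)) * Real.log 2 =
      (1 + α) * Real.log (1 + α) - α * Real.log α := by
    rw [mul_assoc, binEnt_mul_log_two, show 1 - 1 / (1 + α) = α / (1 + α) by field_simp; ring,
      Real.log_div (by positivity) (by positivity), Real.log_div (by positivity) (by positivity),
      Real.log_one]
    field_simp
    ring
  have hcast : Tendsto (fun N : ℕ => (N : ℝ)) atTop atTop := tendsto_natCast_atTop_atTop
  have hinv : Tendsto (fun N : ℕ => (N : ℝ)⁻¹) atTop (𝓝 0) := tendsto_inv_atTop_zero.comp hcast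
  have hq : Tendsto (fun N : ℕ => (⌊α * (N : ℝ)⌋₊ : ℝ) / N) atTop (𝓝 α) :=
    (tendsto_nat_floor_mul_div_atTop hα.le).comp hcast
  have hlog : Tendsto (fun N : ℕ => Real.log N * (N : ℝ)⁻¹) atTop (𝓝 0) := by
    have := Real.isLittleO_log_id_atTop.tendsto_div_nhds_zero.comp hcast
    simpa [Function.comp_def, div_eq_mul_inv] using this
  set t : ℕ → ℝ := fun N => (⌊α * (N : ℝ)⌋₊ : ℝ) / N - (N : ℝ)⁻¹ with ht_def
  have ht : Tendsto t atTop (𝓝 α) := by simpa using hq.sub hinv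
  have hmain : Tendsto (fun N : ℕ => (1 + t N) * Real.log (1 + t N) - t N * Real.log (t N)
      - Real.log (t N) * (N : ℝ)⁻¹ / 2 - Real.log N * (N : ℝ)⁻¹ - 2 * (N : ℝ)⁻¹) atTop
      (𝓝 ((1 + α) * Real.log (1 + α) - α * Real.log α - Real.log α * 0 / 2 - 0 - 2 * 0)) := by
    have h1 := (ht.const_add 1)
    have h2 := ht.log hα.ne'
    have h3 := h1.log (by positivity : 1 + α ≠ 0)
    exact ((((h1.mul h3).sub (ht.mul h2)).sub ((h2.mul hinv).div_const 2)).sub hlog).sub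
      (hinv.const_mul 2)
  have hlt : (1 + α) * Real.log (1 + α) - α * Real.log α - ε * Real.log 2 <
      (1 + α) * Real.log (1 + α) - α * Real.log α - Real.log α * 0 / 2 - 0 - 2 * 0 := by
    have := mul_pos hε (Real.log_pos one_lt_two)
    linarith
  have hfl : Tendsto (fun N : ℕ => ⌊α * (N : ℝ)⌋₊) atTop atTop :=
    tendsto_nat_floor_atTop.comp (hcast.const_mul_atTop hα)
  filter_upwards [hmain.eventually_const_le hlt, hfl.eventually_ge_atTop 2,
    eventually_ge_atTop 1] with N h hq2 hN
  obtain ⟨m, hm⟩ : ∃ m, ⌊α * (N : ℝ)⌋₊ = m + 1 := ⟨⌊α * (N : ℝ)⌋₊ - 1, by omega⟩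
  have hm0 : m ≠ 0 := by omega
  have hN0 : N ≠ 0 := by omega
  have hNpos : (0 : ℝ) < N := by positivity
  have hmpos : (0 : ℝ) < m := by positivity
  have htm : t N = m / N := by
    simp only [ht_def, hm]; push_cast; field_simp; ring
  rw [hm, card_simplex_succ]
  have hC : (0 : ℝ) < ((m + N).choose m : ℝ) := by
    exact_mod_cast Nat.choose_pos (Nat.le_add_right m N)
  rw [← Real.log_le_log_iff (by positivity) hC, Real.log_rpow two_pos]
  refine le_trans ?_ (le_log_choose hm0 hN0)
  have h5 : (1 : ℝ) + m / N = (m + N) / N := by field_simp; ring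
  rw [htm, h5, Real.log_div (by positivity) (by positivity),
    Real.log_div (by positivity) (by positivity)] at h
  have h6 := mul_le_mul_of_nonneg_left h hNpos.le
  calc _ = (N : ℝ) * ((1 + α) * Real.log (1 + α) - α * Real.log α - ε * Real.log 2) := by
        rw [← hG]; ring
    _ ≤ _ := h6
    _ = _ := by field_simp; ring

/-- Balls in the simplex: a point at distance `r` from `x` is `x - u + v` with `u`, `v` of
total mass `r`. -/
theorem card_ball_le_s2 (q N D : ℕ) {x : Fin q → ℕ} (hx : x ∈ simplex q N) :
    ((simplex q N).filter fun y => (∑ k, |(x k : ℝ) - (y k : ℝ)|) / 2 < D).card ≤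
      ∑ r ∈ Finset.range D, (simplex q r).card ^ 2 := by
  calc _ ≤ ((Finset.range D).biUnion fun r => simplex q r ×ˢ simplex q r).card := by
        refine Finset.card_le_card_of_injOn (fun y => (fun k => x k - y k, fun k => y k - x k))
          ?_ ?_
        · intro y hy
          simp only [Finset.coe_filter, Set.mem_ofPred_eq, mem_simplex] at hy
          rw [mem_simplex] at hx
          have hsum : ∑ k, (x k - y k) = ∑ k, (y k - x k) := by
            have : ∑ k, (x k - y k) + ∑ k, y k = ∑ k, (y k - x k) + ∑ k, x k := by
              rw [← Finset.sum_add_distrib, ← Finset.sum_add_distrib]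
              exact Finset.sum_congr rfl fun k _ => by omega
            omega
          have habs : ∑ k, |(x k : ℝ) - (y k : ℝ)| =
              ((∑ k, (x k - y k) + ∑ k, (y k - x k) : ℕ) : ℝ) := by
            rw [← Finset.sum_add_distrib, Nat.cast_sum]
            refine Finset.sum_congr rfl fun k _ => ?_
            rcases le_total (x k) (y k) with h | h
            · rw [Nat.sub_eq_zero_of_le h, zero_add, Nat.cast_sub h, abs_sub_comm, abs_of_nonneg]
              exact sub_nonneg.2 (by exact_mod_cast h)
            · rw [Nat.sub_eq_zero_of_le h, add_zero, Nat.cast_sub h, abs_of_nonneg]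
              exact sub_nonneg.2 (by exact_mod_cast h)
          rw [habs, ← hsum] at hy
          simp only [Finset.coe_biUnion, Set.mem_iUnion, Finset.mem_coe, Finset.mem_range,
            Finset.mem_product, mem_simplex]
          refine ⟨∑ k, (x k - y k), ?_, rfl, hsum.symm⟩
          have := hy.2
          push_cast [-Nat.cast_sum] at this
          rw [add_self_div_two] at this
          exact_mod_cast this
        · intro y _ z _ h
          simp only [Prod.mk.injEq, funext_iff] at h
          funext k
          have := h.1 k
          have := h.2 k
          omega
    _ ≤ ∑ r ∈ Finset.range D, (simplex q r ×ˢ simplex q r).card := Finset.card_biUnion_le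
    _ = _ := by simp [Finset.card_product, sq]

/-- If each section of a relation on `S` has at most `B` points, then the number of
families in `S` with two given distinct coordinates related is at most `B / |S|` times the total. -/
theorem card_filter_piFinset_mul_card_le {ι β : Type*} [Fintype ι] [DecidableEq ι]
    (S : Finset β) (R : β → β → Prop) [DecidableRel R] (B : ℕ) (hB : ∀ x ∈ S, (S.filter fun y => R x y).card ≤ B)
    {i j : ι} (hij : i ≠ j) :
    ((Fintype.piFinset fun _ : ι => S).filter fun f => R (f i) (f j)).card * S.card ≤
      (Fintype.piFinset fun _ : ι => S).card * B := by
  rw [← Finset.card_product]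
  calc _ ≤ ((Fintype.piFinset fun _ : ι => S).sigma fun g => S.filter fun y => R (g i) y).card := by
        refine Finset.card_le_card_of_injOn
          (fun p => ⟨Function.update p.1 j p.2, p.1 j⟩) ?_ ?_
        · rintro ⟨f, s⟩ h
          simp only [Finset.coe_product, Set.mem_prod, Finset.mem_coe, Finset.mem_filter,
            Fintype.mem_piFinset, Finset.mem_sigma, Function.update_of_ne hij] at h ⊢
          refine ⟨fun a => ?_, h.1.1 j, h.1.2⟩
          by_cases ha : a = j
          · subst ha; simpa using h.2
          · simpa [Function.update_of_ne ha] using h.1.1 a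
        · rintro ⟨f, s⟩ _ ⟨g, t⟩ _ h
          simp only [Sigma.mk.injEq, heq_eq_eq] at h
          obtain ⟨h1, h2⟩ := h
          refine Prod.ext (funext fun a => ?_) (by simpa using congrFun h1 j)
          by_cases ha : a = j
          · subst ha; exact h2
          · simpa [Function.update_of_ne ha] using congrFun h1 a
    _ = ∑ g ∈ Fintype.piFinset fun _ : ι => S, (S.filter fun y => R (g i) y).card :=
        Finset.card_sigma _ _
    _ ≤ ∑ _g ∈ Fintype.piFinset fun _ : ι => S, B :=
        Finset.sum_le_sum fun g hg => hB _ (Fintype.mem_piFinset.1 hg i)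
    _ = _ := by rw [Finset.sum_const, smul_eq_mul]

/-- The union bound over pairs of coordinates, in counting form. -/
theorem one_sub_le_card_filter_div_card {n : ℕ} {β : Type*} (S : Finset β) (hS : 0 < S.card)
    (R : β → β → Prop) (B : ℕ) (hB : ∀ x ∈ S, (S.filter fun y => ¬ R x y).card ≤ B) :
    1 - (n : ℝ) ^ 2 * B / S.card ≤
      (((Fintype.piFinset fun _ : Fin n => S).filter
        fun f => ∀ i j : Fin n, i ≠ j → R (f i) (f j)).card : ℝ) /
        ((Fintype.piFinset fun _ : Fin n => S).card : ℝ) := by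
  set T := Fintype.piFinset fun _ : Fin n => S with hT
  have hTpos : 0 < T.card := by
    rw [hT, Fintype.card_piFinset_const]; exact pow_pos hS _
  set P : (Fin n → β) → Prop := fun f => ∀ i j : Fin n, i ≠ j → R (f i) (f j) with hP
  have hsplit : (T.filter P).card + (T.filter fun f => ¬ P f).card = T.card :=
    Finset.card_filter_add_card_filter_not P
  have hbad : (T.filter fun f => ¬ P f).card * S.card ≤ n ^ 2 * (T.card * B) := by
    calc _ ≤ (∑ p ∈ (Finset.univ : Finset (Fin n × Fin n)).filter (fun p => p.1 ≠ p.2),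
          (T.filter fun f => ¬ R (f p.1) (f p.2)).card) * S.card := by
          gcongr
          refine le_trans (Finset.card_le_card ?_) Finset.card_biUnion_le
          intro f hf
          simp only [hP, Finset.mem_filter, not_forall] at hf
          obtain ⟨hf, i, j, hij, hR⟩ := hf
          simp only [Finset.mem_biUnion, Finset.mem_filter, Finset.mem_univ, true_and]
          exact ⟨(i, j), hij, hf, hR⟩
      _ ≤ ∑ _p ∈ (Finset.univ : Finset (Fin n × Fin n)).filter (fun p => p.1 ≠ p.2),
          T.card * B := by
          rw [Finset.sum_mul]
          refine Finset.sum_le_sum fun p hp => ?_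
          exact card_filter_piFinset_mul_card_le S (fun x y => ¬ R x y) B
            hB (Finset.mem_filter.1 hp).2
      _ ≤ ∑ _p : Fin n × Fin n, T.card * B :=
          Finset.sum_le_sum_of_subset (Finset.filter_subset _ _)
      _ = _ := by simp [sq]
  have hS' : (0 : ℝ) < S.card := by exact_mod_cast hS
  have hT' : (0 : ℝ) < T.card := by exact_mod_cast hTpos
  have hsplit' : ((T.filter P).card : ℝ) + (T.filter fun f => ¬ P f).card = T.card := by
    exact_mod_cast hsplit
  have hbad' : ((T.filter fun f => ¬ P f).card : ℝ) * S.card ≤ n ^ 2 * (T.card * B) := by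
    exact_mod_cast hbad
  rw [le_div_iff₀ hT', sub_mul, one_mul, sub_le_iff_le_add, ← hsplit', add_le_add_iff_left,
    hsplit', div_mul_eq_mul_div, le_div_iff₀ hS']
  linarith

theorem sum_card_simplex_sq_le {A δ' : ℝ} (hA : 0 < A) (hδ' : 0 < δ') {m D : ℕ} (hm : m ≤ A)
    (hD : D ≤ δ') :
    ((∑ r ∈ Finset.range D, (simplex (m + 1) r).card ^ 2 : ℕ) : ℝ) ≤
      δ' * ((2 : ℝ) ^ ((A + δ') * binEnt (A / (A + δ')))) ^ 2 := by
  rw [Nat.cast_sum]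
  calc _ ≤ ∑ _r ∈ Finset.range D, ((2 : ℝ) ^ ((A + δ') * binEnt (A / (A + δ')))) ^ 2 := by
        refine Finset.sum_le_sum fun r hr => ?_
        rw [card_simplex_succ, Nat.cast_pow]
        have hr' : (r : ℝ) ≤ δ' := le_trans (by exact_mod_cast (Finset.mem_range.1 hr).le) hD
        exact pow_le_pow_left₀ (Nat.cast_nonneg _) (choose_le_two_rpow_binEnt hA hδ' hm hr') 2
    _ = D * ((2 : ℝ) ^ ((A + δ') * binEnt (A / (A + δ')))) ^ 2 := by simp
    _ ≤ _ := by gcongr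

theorem two_rpow_RU_sq_mul (α δ ε x : ℝ) :
    ((2 : ℝ) ^ (x * (RU δ α - ε))) ^ 2 *
        ((2 : ℝ) ^ (x * ((α + δ) * binEnt (α / (α + δ))))) ^ 2 =
      (2 : ℝ) ^ (-(ε * x)) * (2 : ℝ) ^ (x * ((1 + α) * binEnt (1 / (1 + α)) - ε)) := by
  rw [← mul_pow, ← Real.rpow_add two_pos, ← Real.rpow_add two_pos, ← Real.rpow_natCast,
    ← Real.rpow_mul two_pos.le, RU]
  congr 1
  push_cast
  ring

/-- The union bound over pairs of codewords, with the code size and the ball size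
estimated by their exponential rates. -/
theorem sq_mul_sum_card_simplex_sq_div_le {α δ ε : ℝ} (hα : 0 < α) (hδ : 0 < δ) {l N D m : ℕ}
    (hN : 0 < N) (hm : m ≤ α * N) (hD : D ≤ δ * N)
    (hl : (l : ℝ) ≤ (2 : ℝ) ^ ((N : ℝ) * (RU δ α - ε)))
    (hcard : (2 : ℝ) ^ ((N : ℝ) * ((1 + α) * binEnt (1 / (1 + α)) - ε)) ≤
      ((simplex (m + 1) N).card : ℝ)) :
    (l : ℝ) ^ 2 * (∑ r ∈ Finset.range D, (simplex (m + 1) r).card ^ 2 : ℕ) /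
      (simplex (m + 1) N).card ≤ δ * ((N : ℝ) * (2 : ℝ) ^ (-(ε * (N : ℝ)))) := by
  have hNpos : (0 : ℝ) < N := Nat.cast_pos.2 hN
  have hB := sum_card_simplex_sq_le (mul_pos hα hNpos) (mul_pos hδ hNpos) hm hD
  rw [← add_mul, mul_div_mul_right _ _ hNpos.ne', mul_comm (α + δ) (N : ℝ),
    mul_assoc (N : ℝ)] at hB
  rw [div_le_iff₀ (lt_of_lt_of_le (by positivity) hcard)]
  calc _ ≤ ((2 : ℝ) ^ ((N : ℝ) * (RU δ α - ε))) ^ 2 *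
        (δ * N * ((2 : ℝ) ^ ((N : ℝ) * ((α + δ) * binEnt (α / (α + δ))))) ^ 2) :=
        mul_le_mul (pow_le_pow_left₀ (Nat.cast_nonneg _) hl 2)
          (hB) (Nat.cast_nonneg _) (by positivity)
    _ = δ * (N * (2 : ℝ) ^ (-(ε * (N : ℝ)))) *
        (2 : ℝ) ^ ((N : ℝ) * ((1 + α) * binEnt (1 / (1 + α)) - ε)) := by
      linear_combination δ * N * two_rpow_RU_sq_mul α δ ε N
    _ ≤ _ := mul_le_mul_of_nonneg_left hcard (by positivity)

/-- Uniform random ℓ1 codes are asymptotically good: if `L N ≤ 2^{N (R_U(δ,α) - ε)}`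
eventually, then the probability (under `L N` i.i.d. uniform points of the simplex
`S_{⌊αN⌋,N}`) that all pairwise ℓ1-distances are at least `⌊δN⌋` tends to `1`. -/
theorem uniform_random_ell1_codes_good (α δ ε : ℝ)
    (hα : 0 < α) (hδ0 : 0 < δ) (hδ1 : δ < 1) (hε : 0 < ε)
    (L : ℕ → ℕ) (hLpos : ∀ N, 0 < L N)
    (hLgrowth : ∀ᶠ N in Filter.atTop, (L N : ℝ) ≤ (2 : ℝ) ^ ((N : ℝ) * (RU δ α - ε))) :
    Filter.Tendsto
      (fun N : ℕ =>
        (((Fintype.piFinset fun _ : Fin (L N) => simplex ⌊α * (N : ℝ)⌋₊ N).filter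
            fun f => ∀ i j : Fin (L N), i ≠ j →
              ((⌊δ * (N : ℝ)⌋₊ : ℝ)) ≤ (∑ k, |(f i k : ℝ) - (f j k : ℝ)|) / 2).card : ℝ) /
          ((Fintype.piFinset fun _ : Fin (L N) => simplex ⌊α * (N : ℝ)⌋₊ N).card : ℝ))
      Filter.atTop (nhds 1) := by
  have hcast : Filter.Tendsto (fun N : ℕ => (N : ℝ)) Filter.atTop Filter.atTop :=
    tendsto_natCast_atTop_atTop
  have hlim : Filter.Tendsto (fun N : ℕ => 1 - δ * ((N : ℝ) * (2 : ℝ) ^ (-(ε * (N : ℝ)))))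
      Filter.atTop (nhds 1) := by
    have h := (tendsto_rpow_mul_exp_neg_mul_atTop_nhds_zero 1 (ε * Real.log 2)
      (mul_pos hε (Real.log_pos one_lt_two))).comp hcast
    have h2 := (h.const_mul δ).const_sub 1
    rw [mul_zero, sub_zero] at h2
    refine h2.congr fun N => ?_
    rw [Function.comp_apply, Real.rpow_one, Real.rpow_def_of_pos two_pos]
    ring_nf
  refine tendsto_of_tendsto_of_tendsto_of_le_of_le' hlim tendsto_const_nhds ?_ ?_
  · have hfl : Filter.Tendsto (fun N : ℕ => ⌊α * (N : ℝ)⌋₊) Filter.atTop Filter.atTop :=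
      tendsto_nat_floor_atTop.comp (hcast.const_mul_atTop hα)
    filter_upwards [hLgrowth, eventually_two_rpow_le_card_simplex hα hε,
      hfl.eventually_ge_atTop 1, Filter.eventually_ge_atTop 1] with N hL hcard hq hN
    obtain ⟨m, hm⟩ : ∃ m, ⌊α * (N : ℝ)⌋₊ = m + 1 := ⟨⌊α * (N : ℝ)⌋₊ - 1, by omega⟩
    have hmα : (m : ℝ) ≤ α * N := by
      have h1 := Nat.floor_le (show 0 ≤ α * (N : ℝ) by positivity)
      rw [hm] at h1
      push_cast at h1
      linarith
    have hDδ : (⌊δ * (N : ℝ)⌋₊ : ℝ) ≤ δ * N := Nat.floor_le (by positivity)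
    rw [hm] at hcard ⊢
    have hSpos : 0 < (simplex (m + 1) N).card := by
      rw [← Nat.cast_pos (α := ℝ)]
      exact lt_of_lt_of_le (by positivity) hcard
    have hunion := one_sub_le_card_filter_div_card (n := L N) (simplex (m + 1) N) hSpos
      (fun x y => (⌊δ * (N : ℝ)⌋₊ : ℝ) ≤ (∑ k, |(x k : ℝ) - (y k : ℝ)|) / 2) _
      (fun x hx => by simpa only [not_le] using card_ball_le_s2 _ N ⌊δ * (N : ℝ)⌋₊ hx)
    refine le_trans ((sub_le_sub_left (sq_mul_sum_card_simplex_sq_div_le hα hδ0 (by omega) hmα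
      hDδ hL hcard) 1).trans hunion) (le_of_eq ?_)
    congr!
  · refine Filter.Eventually.of_forall fun N => div_le_one_of_le₀ ?_ (Nat.cast_nonneg _)
    exact_mod_cast Finset.card_filter_le _ _
end

section
/- Multinomial random ℓ1 codes are asymptotically good: Fix α > 0 and let Δ_α = e^{−2/α}·(I₀(2/α) + I₁(2/α)), where I_k is the modified Bessel function of the first kind. Fix δ with 0 < δ < Δ_α and ε > 0, and define R_M(δ,α) = (Δ_α − δ)²/(8 ln 2). Let (L_N)_N be positive integers with L_N ≤ 2^{N·(R_M(δ,α)−ε)} for all sufficiently large N. For each N, let X₁,…,X_{L_N} be independent random vectors in S_{⌊αN⌋,N}, each distributed according to Multinomial(⌊αN⌋, N). Then the probability of the event {for all i ≠ j, (1/2)∑_k |X_i(k) − X_j(k)| ≥ ⌊δN⌋} tends to 1 as N → ∞. -/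
open scoped BigOperators Classical

/-- The modified Bessel function of the first kind of integer order `k`. -/
noncomputable def besselI (k : ℕ) (x : ℝ) : ℝ :=
  (1 / Real.pi) * ∫ θ in (0 : ℝ)..Real.pi, Real.exp (x * Real.cos θ) * Real.cos (k * θ)

/-- The constant `Δ_α = e^{-2/α} (I₀(2/α) + I₁(2/α))`. -/
noncomputable def DeltaAlpha (α : ℝ) : ℝ :=
  Real.exp (-2 / α) * (besselI 0 (2 / α) + besselI 1 (2 / α))

/-- The rate exponent for multinomial random ℓ1 codes. -/
noncomputable def RM (δ α : ℝ) : ℝ := (DeltaAlpha α - δ) ^ 2 / (8 * Real.log 2)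

/-- The `Multinomial(q, N)` probability of observing the occupancy vector `x`:
`(N!/∏ᵢ xᵢ!) q^{-N}` (here `∑ᵢ xᵢ = N` for points of the simplex). -/
noncomputable def multWeight (q N : ℕ) (x : Fin q → ℕ) : ℝ :=
  (Nat.multinomial Finset.univ x : ℝ) / (q : ℝ) ^ N

section Walk

variable {A K : Type*} [AddCommMonoid A] [Fintype K]

/-- The mean of `F` at time `n` of the walk on `A` started at `0` whose independent steps are
uniform among the `v k`. -/
noncomputable def walkMean (v : K → A) : ℕ → (A → ℝ) → ℝ
  | 0, F => F 0
  | n + 1, F => walkMean v n fun a => (∑ k, F (a + v k)) / Fintype.card K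

theorem walkMean_mono (v : K → A) (n : ℕ) {F G : A → ℝ} (h : ∀ a, F a ≤ G a) :
    walkMean v n F ≤ walkMean v n G := by
  induction n generalizing F G with
  | zero => exact h 0
  | succ n ih =>
    refine ih fun a => ?_
    gcongr
    exact h _

theorem walkMean_const_mul (v : K → A) (n : ℕ) (c : ℝ) (F : A → ℝ) :
    walkMean v n (fun a => c * F a) = c * walkMean v n F := by
  induction n generalizing F with
  | zero => rfl
  | succ n ih =>
    simp only [walkMean, ← ih, ← Finset.mul_sum, mul_div_assoc]

theorem walkMean_add (v : K → A) (n : ℕ) (F G : A → ℝ) :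
    walkMean v n (fun a => F a + G a) = walkMean v n F + walkMean v n G := by
  induction n generalizing F G with
  | zero => rfl
  | succ n ih =>
    simp only [walkMean, ← ih, Finset.sum_add_distrib, add_div]

theorem walkMean_zero (v : K → A) (n : ℕ) : walkMean v n (fun _ => 0) = 0 := by
  simpa using walkMean_const_mul v n 0 fun _ => 0

theorem walkMean_sum {ι : Type*} (v : K → A) (n : ℕ) (s : Finset ι) (F : ι → A → ℝ) :
    walkMean v n (fun a => ∑ i ∈ s, F i a) = ∑ i ∈ s, walkMean v n (F i) := by
  classical
  induction s using Finset.induction_on with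
  | empty => simpa using walkMean_zero v n
  | insert i s hi ih => simp only [Finset.sum_insert hi, walkMean_add, ih]

theorem walkMean_integral (v : K → A) (n : ℕ) (f : A → ℝ → ℝ) (hf : ∀ a, Continuous (f a))
    (x y : ℝ) :
    walkMean v n (fun a => ∫ θ in x..y, f a θ) = ∫ θ in x..y, walkMean v n fun a => f a θ := by
  induction n generalizing f with
  | zero => rfl
  | succ n ih =>
    simp only [walkMean]
    rw [← ih (fun a θ => (∑ k, f (a + v k) θ) / Fintype.card K) (fun a => by fun_prop)]
    congr 1
    funext a
    rw [intervalIntegral.integral_div, intervalIntegral.integral_finsetSum]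
    exact fun k _ => (hf _).intervalIntegrable _ _

/-- Hoeffding's lemma for the uniform distribution on a finite type. -/
theorem average_exp_le [Nonempty K] (f : K → ℝ) (hf : ∀ k l, f k - f l ≤ 2) (s : ℝ) :
    (∑ k, Real.exp (s * f k)) / Fintype.card K ≤
      Real.exp (s ^ 2 / 2) * Real.exp (s * ((∑ k, f k) / Fintype.card K)) := by
  let _ : MeasurableSpace K := ⊤
  obtain ⟨k₀, hk₀⟩ := Finite.exists_min f
  have key : ∀ g : K → ℝ, ∫ k, g k ∂(PMF.uniformOfFintype K).toMeasure
      = (∑ k, g k) / Fintype.card K := by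
    intro g
    rw [PMF.integral_eq_sum, Finset.sum_div]
    refine Finset.sum_congr rfl fun k _ => ?_
    simp [PMF.uniformOfFintype_apply, div_eq_inv_mul]
  have hsub := ProbabilityTheory.hasSubgaussianMGF_of_mem_Icc
    (μ := (PMF.uniformOfFintype K).toMeasure) (X := f) (a := f k₀) (b := f k₀ + 2)
    (measurable_of_finite f).aemeasurable
    (Filter.Eventually.of_forall fun k => ⟨hk₀ k, by linarith [hf k k₀]⟩)
  have h := hsub.mgf_le s
  rw [ProbabilityTheory.mgf, key, key] at h
  set m := (∑ k, f k) / Fintype.card K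
  have hc : ((((‖f k₀ + 2 - f k₀‖₊ / 2) ^ 2 : NNReal) : ℝ)) * s ^ 2 / 2 = s ^ 2 / 2 := by
    simp
  rw [hc] at h
  calc (∑ k, Real.exp (s * f k)) / Fintype.card K
      = (∑ k, Real.exp (s * (f k - m))) / Fintype.card K * Real.exp (s * m) := by
        rw [div_mul_eq_mul_div, Finset.sum_mul]
        congr 1
        refine Finset.sum_congr rfl fun k _ => ?_
        rw [← Real.exp_add]
        ring_nf
    _ ≤ _ := by gcongr

/-- Exponential moment bound for a function of a walk that changes by at most `2` when one step
is altered. -/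
theorem walkMean_exp_le [Nonempty K] (v : K → A) (n : ℕ) (F : A → ℝ)
    (hF : ∀ a k l, F (a + v k) - F (a + v l) ≤ 2) (s : ℝ) :
    walkMean v n (fun a => Real.exp (s * F a)) ≤
      Real.exp (n * (s ^ 2 / 2)) * Real.exp (s * walkMean v n F) := by
  induction n generalizing F with
  | zero => simp [walkMean]
  | succ n ih =>
    have hcard : (0 : ℝ) < Fintype.card K := by exact_mod_cast Fintype.card_pos
    calc walkMean v (n + 1) (fun a => Real.exp (s * F a))
        ≤ walkMean v n (fun a => Real.exp (s ^ 2 / 2) *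
            Real.exp (s * ((∑ k, F (a + v k)) / Fintype.card K))) :=
          walkMean_mono v n fun a => average_exp_le _ (hF a) s
      _ = Real.exp (s ^ 2 / 2) * walkMean v n (fun a =>
            Real.exp (s * ((∑ k, F (a + v k)) / Fintype.card K))) := walkMean_const_mul ..
      _ ≤ Real.exp (s ^ 2 / 2) * (Real.exp (n * (s ^ 2 / 2)) *
            Real.exp (s * walkMean v (n + 1) F)) := by
          gcongr
          refine ih _ fun a k l => ?_
          rw [← sub_div, div_le_iff₀ hcard, ← Finset.sum_sub_distrib]
          calc ∑ m, (F (a + v k + v m) - F (a + v l + v m)) ≤ ∑ _m : K, (2 : ℝ) := by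
                refine Finset.sum_le_sum fun m _ => ?_
                rw [add_right_comm a (v k), add_right_comm a (v l)]
                exact hF _ _ _
            _ = 2 * Fintype.card K := by simp [mul_comm]
      _ = _ := by
          rw [← mul_assoc, ← Real.exp_add]
          push_cast
          ring_nf

end Walk

/-- The difference of two standard basis vectors of `ℤ ^ q`. -/
def basisDiff (q : ℕ) (k : Fin q × Fin q) : Fin q → ℤ := Pi.single k.1 1 - Pi.single k.2 1

/-- The ℓ1-norm, halved. -/
noncomputable def halfNorm {q : ℕ} (a : Fin q → ℤ) : ℝ := (∑ i, |(a i : ℝ)|) / 2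

theorem halfNorm_add_basisDiff_sub_le {q : ℕ} (a : Fin q → ℤ) (k l : Fin q × Fin q) :
    halfNorm (a + basisDiff q k) - halfNorm (a + basisDiff q l) ≤ 2 := by
  have h : ∀ i, |((a + basisDiff q k) i : ℝ)| - |((a + basisDiff q l) i : ℝ)| ≤
      (if i = k.1 then 1 else 0) + (if i = k.2 then 1 else 0) +
      (if i = l.1 then 1 else 0) + (if i = l.2 then 1 else 0) := by
    intro i
    refine (abs_sub_abs_le_abs_sub _ _).trans ?_
    simp only [basisDiff, Pi.add_apply, Pi.sub_apply, Pi.single_apply]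
    rw [abs_le]
    push_cast
    constructor <;> split_ifs <;> norm_num
  have := Finset.sum_le_sum fun i (_ : i ∈ Finset.univ) => h i
  simp only [Finset.sum_add_distrib, Finset.sum_ite_eq', Finset.sum_sub_distrib,
    Finset.mem_univ, if_true] at this
  simp only [halfNorm]
  linarith

/-- Half the probability that one step of the difference walk moves a given coordinate. -/
noncomputable def moveProb (q : ℕ) : ℝ := 1 / q - 1 / (q : ℝ) ^ 2

theorem average_basisDiff {q : ℕ} (i : Fin q) (h : ℤ → ℝ) (a : Fin q → ℤ) :
    (∑ k, h ((a + basisDiff q k) i)) / Fintype.card (Fin q × Fin q) =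
      h (a i) + moveProb q * (h (a i + 1) + h (a i - 1) - 2 * h (a i)) := by
  have hq : (q : ℝ) ≠ 0 := by
    have := i.pos
    positivity
  have hk : ∀ k l : Fin q, h ((a + basisDiff q (k, l)) i) =
      h (a i) + (if i = k then h (a i + 1) - h (a i) else 0) +
      (if i = l then h (a i - 1) - h (a i) else 0) +
      (if i = k then 1 else 0) *
        (if i = l then 2 * h (a i) - h (a i + 1) - h (a i - 1) else 0) := by
    intro k l
    simp only [basisDiff, Pi.add_apply, Pi.sub_apply, Pi.single_apply]
    split_ifs <;> simp [sub_eq_add_neg] <;> ring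
  rw [Fintype.sum_prod_type]
  simp only [hk, Finset.sum_add_distrib, ← Finset.mul_sum, ← Finset.sum_mul, Finset.sum_ite_eq,
    Finset.mem_univ, if_true, Finset.sum_const, Finset.card_univ, Fintype.card_fin,
    Fintype.card_prod, nsmul_eq_mul, moveProb]
  push_cast
  field_simp
  ring

theorem walkMean_cos {q : ℕ} (i : Fin q) (n : ℕ) (θ : ℝ) :
    walkMean (basisDiff q) n (fun a => Real.cos (a i * θ)) =
      (1 - 2 * moveProb q * (1 - Real.cos θ)) ^ n := by
  induction n with
  | zero => simp [walkMean]
  | succ n ih =>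
    rw [pow_succ', ← ih, ← walkMean_const_mul]
    simp only [walkMean]
    congr 1
    funext a
    rw [average_basisDiff i (fun z => Real.cos (z * θ))]
    push_cast
    rw [add_mul, sub_mul, one_mul, Real.cos_add, Real.cos_sub]
    ring

theorem integral_cos_int_mul (z : ℤ) :
    ∫ θ in (0 : ℝ)..Real.pi, Real.cos (z * θ) = if z = 0 then Real.pi else 0 := by
  split_ifs with hz
  · simp [hz]
  · have hz' : (z : ℝ) ≠ 0 := by exact_mod_cast hz
    rw [intervalIntegral.integral_comp_mul_left _ hz', integral_cos]
    simp [Real.sin_int_mul_pi]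

theorem walkMean_eq_zero {q : ℕ} (i : Fin q) (n : ℕ) :
    walkMean (basisDiff q) n (fun a => if a i = 0 then Real.pi else 0) =
      ∫ θ in (0 : ℝ)..Real.pi, (1 - 2 * moveProb q * (1 - Real.cos θ)) ^ n := by
  simp only [← integral_cos_int_mul, ← walkMean_cos i]
  exact walkMean_integral _ _ _ (fun a => by fun_prop) _ _

theorem integral_one_sub_mul_pow (c : ℝ) (n : ℕ) :
    ∫ θ in (0 : ℝ)..Real.pi, (1 - c * (1 - Real.cos θ)) ^ n =
      (n + 1) * (∫ θ in (0 : ℝ)..Real.pi,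
        (1 + Real.cos θ) * (1 - c * (1 - Real.cos θ)) ^ n) -
      n * ∫ θ in (0 : ℝ)..Real.pi,
        (1 + Real.cos θ) * (1 - c * (1 - Real.cos θ)) ^ (n - 1) := by
  have hderiv : ∀ θ : ℝ, HasDerivAt (fun θ => Real.sin θ * (1 - c * (1 - Real.cos θ)) ^ n)
      ((n + 1) * ((1 + Real.cos θ) * (1 - c * (1 - Real.cos θ)) ^ n) -
        n * ((1 + Real.cos θ) * (1 - c * (1 - Real.cos θ)) ^ (n - 1)) -
        (1 - c * (1 - Real.cos θ)) ^ n) θ := by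
    intro θ
    have h1 : HasDerivAt (fun θ => 1 - c * (1 - Real.cos θ)) (-(c * Real.sin θ)) θ := by
      have := (((Real.hasDerivAt_cos θ).const_sub 1).const_mul c).const_sub 1
      simpa using this
    refine ((Real.hasDerivAt_sin θ).fun_mul (h1.fun_pow n)).congr_deriv ?_
    rcases n with _ | n
    · simp
    · rw [Nat.add_sub_cancel, pow_succ]
      push_cast
      linear_combination -(n + 1) * c * (1 - c * (1 - Real.cos θ)) ^ n *
        (Real.sin_sq_add_cos_sq θ)
  have h := intervalIntegral.integral_eq_sub_of_hasDerivAt (a := 0) (b := Real.pi)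
    (fun θ _ => hderiv θ) (Continuous.intervalIntegrable (by fun_prop) _ _)
  rw [intervalIntegral.integral_sub (Continuous.intervalIntegrable (by fun_prop) _ _)
      (Continuous.intervalIntegrable (by fun_prop) _ _),
    intervalIntegral.integral_sub (Continuous.intervalIntegrable (by fun_prop) _ _)
      (Continuous.intervalIntegrable (by fun_prop) _ _),
    intervalIntegral.integral_const_mul, intervalIntegral.integral_const_mul] at h
  simp only [Real.sin_pi, Real.sin_zero, zero_mul, sub_zero] at h
  linarith

theorem abs_intCast_add_one_add (z : ℤ) :
    |((z + 1 : ℤ) : ℝ)| + |((z - 1 : ℤ) : ℝ)| - 2 * |(z : ℝ)| = if z = 0 then 2 else 0 := by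
  norm_cast
  rcases lt_trichotomy z 0 with hz | rfl | hz
  · rw [abs_of_neg hz, abs_of_nonpos (by lia), abs_of_neg (by lia), if_neg hz.ne]
    ring
  · simp
  · rw [abs_of_pos hz, abs_of_pos (by lia), abs_of_nonneg (by lia), if_neg hz.ne']
    ring

theorem walkMean_abs {q : ℕ} (i : Fin q) (n : ℕ) :
    walkMean (basisDiff q) n (fun a => |(a i : ℝ)|) =
      2 * moveProb q * n / Real.pi * ∫ θ in (0 : ℝ)..Real.pi,
        (1 + Real.cos θ) * (1 - 2 * moveProb q * (1 - Real.cos θ)) ^ (n - 1) := by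
  induction n with
  | zero => simp [walkMean]
  | succ n ih =>
    have hstep : walkMean (basisDiff q) (n + 1) (fun a => |(a i : ℝ)|) =
        walkMean (basisDiff q) n (fun a => |(a i : ℝ)|) + 2 * moveProb q / Real.pi *
          walkMean (basisDiff q) n (fun a => if a i = 0 then Real.pi else 0) := by
      rw [← walkMean_const_mul, ← walkMean_add]
      simp only [walkMean]
      congr 1
      funext a
      rw [average_basisDiff i (fun z => |(z : ℝ)|), abs_intCast_add_one_add]
      split_ifs
      · field_simp
      · simp
    rw [hstep, ih, walkMean_eq_zero, integral_one_sub_mul_pow]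
    simp only [Nat.add_sub_cancel]
    push_cast
    ring

theorem walkMean_halfNorm (q n : ℕ) :
    walkMean (basisDiff q) n halfNorm =
      q * moveProb q * n / Real.pi * ∫ θ in (0 : ℝ)..Real.pi,
        (1 + Real.cos θ) * (1 - 2 * moveProb q * (1 - Real.cos θ)) ^ (n - 1) := by
  have h : (halfNorm : (Fin q → ℤ) → ℝ) = fun a => 1 / 2 * ∑ i, |(a i : ℝ)| := by
    funext a
    simp only [halfNorm]
    ring
  rw [h, walkMean_const_mul, walkMean_sum]
  simp only [walkMean_abs, Finset.sum_const, Finset.card_univ, Fintype.card_fin, nsmul_eq_mul]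
  ring

theorem succ_mul_multinomial_add_single {ι : Type*} [Fintype ι] [DecidableEq ι] (x : ι → ℕ)
    (k : ι) :
    (x k + 1) * Nat.multinomial Finset.univ (x + Pi.single k 1) =
      (∑ i, x i + 1) * Nat.multinomial Finset.univ x := by
  have h1 := Nat.multinomial_spec Finset.univ (x + Pi.single k 1)
  have h2 := Nat.multinomial_spec Finset.univ x
  have h3 : ∏ i, ((x + Pi.single k 1 : ι → ℕ) i).factorial =
      (∏ i, (x i).factorial) * (x k + 1) := by
    have : x k + 1 = ∏ i, if i = k then x i + 1 else 1 := by simp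
    rw [this, ← Finset.prod_mul_distrib]
    refine Finset.prod_congr rfl fun i _ => ?_
    by_cases h : i = k
    · subst h
      simp [Nat.factorial_succ, mul_comm]
    · simp [h]
  have h4 : ∑ i, (x + Pi.single k 1 : ι → ℕ) i = ∑ i, x i + 1 := by
    simp [Finset.sum_add_distrib]
  rw [h3, h4, Nat.factorial_succ, ← h2] at h1
  have h5 : 0 < ∏ i, (x i).factorial := Finset.prod_pos fun i _ => Nat.factorial_pos _
  refine Nat.eq_of_mul_eq_mul_left h5 ?_
  linarith

theorem sum_simplex_succ {q : ℕ} (hq : q ≠ 0) (n : ℕ) (F : (Fin q → ℕ) → ℝ) :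
    ∑ x ∈ simplex q (n + 1), multWeight q (n + 1) x * F x =
      ∑ x ∈ simplex q n, multWeight q n x * ((∑ k, F (x + Pi.single k 1)) / q) := by
  have hq' : (q : ℝ) ≠ 0 := by exact_mod_cast hq
  have hn : (n + 1 : ℝ) ≠ 0 := by positivity
  have key : ∀ k : Fin q, ∑ x ∈ simplex q n, multWeight q n x * F (x + Pi.single k 1) / q =
      ∑ x ∈ simplex q (n + 1), x k / (n + 1 : ℝ) * (multWeight q (n + 1) x * F x) := by
    intro k
    refine Finset.sum_of_injOn (fun x => x + Pi.single k 1) (add_left_injective _).injOn ?_ ?_ ?_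
    · intro x hx
      simp only [simplex, Finset.mem_coe, Finset.Nat.mem_antidiagonalTuple] at hx ⊢
      simp [Finset.sum_add_distrib, hx]
    · intro x hx hx'
      have : x k = 0 := by
        by_contra hk
        have hle : Pi.single k 1 ≤ x := by
          intro i
          rw [Pi.single_apply]
          split_ifs with h
          · subst h
            exact Nat.one_le_iff_ne_zero.2 hk
          · exact Nat.zero_le _
        refine hx' ⟨x - Pi.single k 1, ?_, tsub_add_cancel_of_le hle⟩
        simp only [simplex, Finset.mem_coe, Finset.Nat.mem_antidiagonalTuple] at hx ⊢
        rw [← tsub_add_cancel_of_le hle] at hx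
        simpa [Finset.sum_add_distrib] using hx
      simp [this]
    · intro x hx
      simp only [simplex, Finset.Nat.mem_antidiagonalTuple] at hx
      have h := succ_mul_multinomial_add_single x k
      rw [hx] at h
      have h' : (x k + 1 : ℝ) * Nat.multinomial Finset.univ (x + Pi.single k 1) =
          (n + 1) * Nat.multinomial Finset.univ x := by exact_mod_cast h
      simp only [multWeight, Pi.add_apply, Pi.single_eq_same, pow_succ]
      push_cast
      field_simp
      linear_combination -F (x + Pi.single k 1) * h'
  calc ∑ x ∈ simplex q (n + 1), multWeight q (n + 1) x * F x
      = ∑ x ∈ simplex q (n + 1), ∑ k, x k / (n + 1 : ℝ) * (multWeight q (n + 1) x * F x) := by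
        refine Finset.sum_congr rfl fun x hx => ?_
        simp only [simplex, Finset.Nat.mem_antidiagonalTuple] at hx
        rw [← Finset.sum_mul, ← Finset.sum_div, ← Nat.cast_sum, hx]
        push_cast
        rw [div_self hn, one_mul]
    _ = ∑ x ∈ simplex q n, ∑ k, multWeight q n x * F (x + Pi.single k 1) / q := by
        rw [Finset.sum_comm, Finset.sum_comm (s := simplex q n)]
        exact Finset.sum_congr rfl fun k _ => (key k).symm
    _ = _ := by
        refine Finset.sum_congr rfl fun x _ => ?_
        rw [← Finset.sum_div, ← Finset.mul_sum, mul_div_assoc]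

theorem simplex_zero (q : ℕ) : simplex q 0 = {0} := by
  ext x
  simp [simplex, Finset.Nat.mem_antidiagonalTuple, funext_iff]

theorem multWeight_zero (q : ℕ) : multWeight q 0 0 = 1 := by
  simp [multWeight, Nat.multinomial]

theorem multWeight_nonneg (q n : ℕ) (x : Fin q → ℕ) : 0 ≤ multWeight q n x := by
  unfold multWeight
  positivity

theorem sum_multWeight {q : ℕ} (hq : q ≠ 0) (n : ℕ) :
    ∑ x ∈ simplex q n, multWeight q n x = 1 := by
  induction n with
  | zero => simp [simplex_zero, multWeight_zero]
  | succ n ih =>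
    have hq' : (q : ℝ) ≠ 0 := by exact_mod_cast hq
    simpa [div_self hq', ih] using sum_simplex_succ hq n fun _ => 1

/-- The difference of two independent multinomial vectors is a random walk. -/
theorem sum_sum_multWeight {q : ℕ} (hq : q ≠ 0) (n : ℕ) (F : (Fin q → ℤ) → ℝ) :
    ∑ x ∈ simplex q n, ∑ y ∈ simplex q n, multWeight q n x * multWeight q n y *
        F (fun i => (x i : ℤ) - y i) = walkMean (basisDiff q) n F := by
  induction n generalizing F with
  | zero =>
    simp only [simplex_zero, Finset.sum_singleton, multWeight_zero, walkMean]
    simp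
    rfl
  | succ n ih =>
    simp only [walkMean, ← ih, mul_assoc, ← Finset.mul_sum]
    rw [sum_simplex_succ hq n
      (fun x => ∑ y ∈ simplex q (n + 1), multWeight q (n + 1) y * F (fun i => (x i : ℤ) - y i))]
    refine Finset.sum_congr rfl fun x _ => ?_
    congr 1
    simp only [fun x : Fin q → ℕ => sum_simplex_succ hq n fun y => F (fun i => (x i : ℤ) - y i)]
    rw [Finset.sum_comm, Finset.sum_div]
    refine Finset.sum_congr rfl fun y _ => ?_
    rw [← Finset.mul_sum, mul_div_assoc, ← Finset.sum_div, div_div, Fintype.sum_prod_type,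
      Fintype.card_prod, Fintype.card_fin]
    push_cast
    congr! 6 with k _ l _ i
    simp only [basisDiff, Pi.add_apply, Pi.sub_apply, Pi.single_apply]
    push_cast
    ring

section UnionBound

variable {ι β : Type*} [Fintype ι]

theorem sum_piFinset_prod [DecidableEq ι] {S : Finset β} {w : β → ℝ} (hw : ∑ x ∈ S, w x = 1) :
    ∑ f ∈ Fintype.piFinset fun _ : ι => S, ∏ i, w (f i) = 1 := by
  rw [← Finset.prod_univ_sum (fun _ => S) fun _ => w]
  simp [hw]

/-- The joint law of two distinct coordinates of a product distribution. -/
theorem sum_piFinset_pair [DecidableEq ι] {S : Finset β} {w : β → ℝ} (hw : ∑ x ∈ S, w x = 1)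
    {i j : ι} (hij : i ≠ j) (F : β → β → ℝ) :
    ∑ f ∈ Fintype.piFinset fun _ : ι => S, F (f i) (f j) * ∏ k, w (f k) =
      ∑ x ∈ S, ∑ y ∈ S, F x y * (w x * w y) := by
  classical
  have key : ∀ x ∈ S, ∀ y ∈ S, ∑ f ∈ Fintype.piFinset fun _ : ι => S,
      (if f i = x then 1 else 0) * (if f j = y then 1 else 0) * ∏ k, w (f k) = w x * w y := by
    intro x hx y hy
    have h : ∀ f : ι → β, (if f i = x then 1 else 0) * (if f j = y then 1 else 0) *
        ∏ k, w (f k) = ∏ k, ((if k = i then (if f k = x then 1 else 0) else 1) *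
          (if k = j then (if f k = y then 1 else 0) else 1) * w (f k)) := by
      intro f
      simp only [Finset.prod_mul_distrib, Finset.prod_ite_eq', Finset.mem_univ, if_true]
    simp only [h]
    rw [← Finset.prod_univ_sum (fun _ => S) fun k z => ((if k = i then (if z = x then 1 else 0)
      else 1) * (if k = j then (if z = y then 1 else 0) else 1) * w z)]
    rw [← Finset.mul_prod_erase _ _ (Finset.mem_univ i), ← Finset.mul_prod_erase _ _
      (Finset.mem_erase.2 ⟨hij.symm, Finset.mem_univ j⟩), Finset.prod_eq_one, mul_one]
    · simp [hij, hij.symm, hx, hy]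
    · intro k hk
      simp only [Finset.mem_erase] at hk
      simp [hk.1, hk.2.1, hw]
  calc ∑ f ∈ Fintype.piFinset fun _ : ι => S, F (f i) (f j) * ∏ k, w (f k)
      = ∑ f ∈ Fintype.piFinset fun _ : ι => S, ∑ x ∈ S, ∑ y ∈ S, F x y *
          ((if f i = x then 1 else 0) * (if f j = y then 1 else 0) * ∏ k, w (f k)) := by
        refine Finset.sum_congr rfl fun f hf => ?_
        have hf' := Fintype.mem_piFinset.1 hf
        rw [Finset.sum_eq_single_of_mem _ (hf' i), Finset.sum_eq_single_of_mem _ (hf' j)]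
        · simp
        · intro y _ hy
          simp [hy.symm]
        · intro x _ hx
          simp [hx.symm]
    _ = ∑ x ∈ S, ∑ y ∈ S, F x y * (w x * w y) := by
        rw [Finset.sum_comm]
        refine Finset.sum_congr rfl fun x hx => ?_
        rw [Finset.sum_comm]
        refine Finset.sum_congr rfl fun y hy => ?_
        rw [← Finset.mul_sum, key x hx y hy]

open Classical in
/-- Union bound over all pairs of an i.i.d. family. -/
theorem one_sub_le_sum_piFinset [DecidableEq ι] {S : Finset β} {w : β → ℝ} (hw0 : ∀ x, 0 ≤ w x)
    (hw : ∑ x ∈ S, w x = 1) (G : β → β → Prop) {p : ℝ} (hp0 : 0 ≤ p)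
    (hp : ∑ x ∈ S, ∑ y ∈ S, (if G x y then 0 else 1) * (w x * w y) ≤ p) :
    1 - (Fintype.card ι : ℝ) ^ 2 * p ≤ ∑ f ∈ Fintype.piFinset fun _ : ι => S,
      if ∀ i j, i ≠ j → G (f i) (f j) then ∏ i, w (f i) else 0 := by
  have hprod : ∀ f : ι → β, 0 ≤ ∏ k, w (f k) := fun f => Finset.prod_nonneg fun _ _ => hw0 _
  have hpt : ∀ f : ι → β, ∏ k, w (f k) - (∑ i, ∑ j, if i ≠ j then
      (if G (f i) (f j) then 0 else 1) * ∏ k, w (f k) else 0) ≤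
      if ∀ i j, i ≠ j → G (f i) (f j) then ∏ i, w (f i) else 0 := by
    intro f
    have hnn : ∀ i j, 0 ≤ if i ≠ j then
        (if G (f i) (f j) then 0 else 1) * ∏ k, w (f k) else 0 := by
      intro i j
      split_ifs <;> simp [hprod]
    split_ifs with hG
    · exact sub_le_self _ (Finset.sum_nonneg fun i _ => Finset.sum_nonneg fun j _ => hnn i j)
    · push Not at hG
      obtain ⟨i, j, hij, hG⟩ := hG
      have h1 := Finset.single_le_sum (fun j _ => hnn i j) (Finset.mem_univ j)
      have h2 := Finset.single_le_sum (fun i _ => Finset.sum_nonneg (s := Finset.univ)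
        fun j _ => hnn i j) (Finset.mem_univ i)
      rw [if_pos hij, if_neg hG, one_mul] at h1
      linarith
  refine le_trans ?_ (Finset.sum_le_sum fun f _ => hpt f)
  rw [Finset.sum_sub_distrib, sum_piFinset_prod hw]
  gcongr
  rw [Finset.sum_comm]
  calc _ ≤ ∑ _i : ι, ∑ _j : ι, p := by
        refine Finset.sum_le_sum fun i _ => ?_
        rw [Finset.sum_comm]
        refine Finset.sum_le_sum fun j _ => ?_
        by_cases hij : i = j
        · simpa [hij] using hp0
        · simp only [ne_eq, hij, not_false_eq_true, if_true]
          rwa [sum_piFinset_pair hw hij fun x y => if G x y then 0 else 1]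
    _ = _ := by simp [sq, mul_assoc]

end UnionBound

theorem moveProb_nonneg (q : ℕ) : 0 ≤ moveProb q := by
  rcases Nat.eq_zero_or_pos q with rfl | hq
  · simp [moveProb]
  · have hq' : (1 : ℝ) ≤ q := by exact_mod_cast hq
    rw [moveProb, sub_nonneg]
    exact one_div_le_one_div_of_le (by positivity) (by nlinarith)

theorem moveProb_le (q : ℕ) : moveProb q ≤ 1 / 4 := by
  have h : moveProb q = 1 / q - (1 / (q : ℝ)) ^ 2 := by simp [moveProb]
  rw [h]
  nlinarith [sq_nonneg (1 / (q : ℝ) - 1 / 2)]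

theorem one_sub_moveProb_mem_Icc (q : ℕ) (θ : ℝ) :
    1 - 2 * moveProb q * (1 - Real.cos θ) ∈ Set.Icc (0 : ℝ) 1 := by
  have h1 := moveProb_nonneg q
  have h2 := moveProb_le q
  have h3 := Real.neg_one_le_cos θ
  have h4 := Real.cos_le_one θ
  constructor <;> nlinarith

theorem le_walkMean_halfNorm (q n : ℕ) :
    n * (q * moveProb q * (1 / Real.pi * ∫ θ in (0 : ℝ)..Real.pi,
      (1 + Real.cos θ) * (1 - 2 * moveProb q * (1 - Real.cos θ)) ^ n)) ≤
      walkMean (basisDiff q) n halfNorm := by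
  have hm := moveProb_nonneg q
  have hpi := Real.pi_pos
  rw [walkMean_halfNorm]
  have hmono : ∫ θ in (0 : ℝ)..Real.pi,
      (1 + Real.cos θ) * (1 - 2 * moveProb q * (1 - Real.cos θ)) ^ n ≤
      ∫ θ in (0 : ℝ)..Real.pi,
        (1 + Real.cos θ) * (1 - 2 * moveProb q * (1 - Real.cos θ)) ^ (n - 1) := by
    refine intervalIntegral.integral_mono_on hpi.le
      (Continuous.intervalIntegrable (by fun_prop) _ _)
      (Continuous.intervalIntegrable (by fun_prop) _ _) fun θ _ => ?_
    have h := one_sub_moveProb_mem_Icc q θ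
    have h3 := Real.neg_one_le_cos θ
    exact mul_le_mul_of_nonneg_left (pow_le_pow_of_le_one h.1 h.2 (Nat.sub_le _ _)) (by linarith)
  calc _ = q * moveProb q * n / Real.pi * ∫ θ in (0 : ℝ)..Real.pi,
        (1 + Real.cos θ) * (1 - 2 * moveProb q * (1 - Real.cos θ)) ^ n := by ring
    _ ≤ _ := by gcongr

theorem DeltaAlpha_eq_integral (α : ℝ) :
    DeltaAlpha α = 1 / Real.pi * ∫ θ in (0 : ℝ)..Real.pi,
      (1 + Real.cos θ) * Real.exp (-(2 / α * (1 - Real.cos θ))) := by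
  unfold DeltaAlpha besselI
  rw [← mul_add, ← intervalIntegral.integral_add (Continuous.intervalIntegrable (by fun_prop) _ _)
    (Continuous.intervalIntegrable (by fun_prop) _ _), mul_left_comm,
    ← intervalIntegral.integral_const_mul]
  congr 1
  refine intervalIntegral.integral_congr fun θ _ => ?_
  have h : Real.exp (-(2 / α * (1 - Real.cos θ))) =
      Real.exp (-2 / α) * Real.exp (2 / α * Real.cos θ) := by
    rw [← Real.exp_add]
    ring_nf
  simp only [h]
  push_cast
  rw [zero_mul, Real.cos_zero, one_mul]
  ring

open Filter Topology in
theorem tendsto_moveProb_integral {q : ℕ → ℕ} {x : ℝ}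
    (hq : Tendsto (fun n : ℕ => (n : ℝ) * (2 * moveProb (q n))) atTop (𝓝 x)) :
    Tendsto (fun n => ∫ θ in (0 : ℝ)..Real.pi,
        (1 + Real.cos θ) * (1 - 2 * moveProb (q n) * (1 - Real.cos θ)) ^ n) atTop
      (𝓝 (∫ θ in (0 : ℝ)..Real.pi,
        (1 + Real.cos θ) * Real.exp (-(x * (1 - Real.cos θ))))) := by
  refine intervalIntegral.tendsto_integral_filter_of_dominated_convergence (fun _ => 2)
    (Eventually.of_forall fun n => Continuous.aestronglyMeasurable (by fun_prop))
    (Eventually.of_forall fun n => Eventually.of_forall fun θ _ => ?_) (by simp)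
    (Eventually.of_forall fun θ _ => ?_)
  · have h := one_sub_moveProb_mem_Icc (q n) θ
    have h3 := Real.neg_one_le_cos θ
    have h4 := Real.cos_le_one θ
    rw [Real.norm_of_nonneg (mul_nonneg (by linarith) (pow_nonneg h.1 _))]
    calc _ ≤ (1 + 1) * (1 : ℝ) := by
          gcongr
          · exact pow_nonneg h.1 _
          · exact pow_le_one₀ h.1 h.2
      _ = 2 := by norm_num
  · refine Tendsto.const_mul _ ?_
    have h : Tendsto (fun n : ℕ => (n : ℝ) * (-(2 * moveProb (q n) * (1 - Real.cos θ)))) atTop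
        (𝓝 (-(x * (1 - Real.cos θ)))) := by
      refine (hq.mul_const (1 - Real.cos θ)).neg.congr fun n => ?_
      ring
    simpa [sub_eq_add_neg] using Real.tendsto_one_add_pow_exp_of_tendsto h

open Filter Topology in
/-- Every rate below `DeltaAlpha α` is eventually exceeded by the mean distance. -/
theorem eventually_mul_le_walkMean {α μ : ℝ} (hα : 0 < α) (hμ : μ < DeltaAlpha α) :
    ∀ᶠ n : ℕ in atTop,
      n * μ ≤ walkMean (basisDiff ⌊α * (n : ℝ)⌋₊) n halfNorm := by
  have hdiv : Tendsto (fun n : ℕ => (⌊α * (n : ℝ)⌋₊ : ℝ) / n) atTop (𝓝 α) :=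
    (tendsto_nat_floor_mul_div_atTop hα.le).comp tendsto_natCast_atTop_atTop
  have hq : Tendsto (fun n : ℕ => ⌊α * (n : ℝ)⌋₊) atTop atTop :=
    tendsto_nat_floor_atTop.comp (tendsto_natCast_atTop_atTop.const_mul_atTop hα)
  have hinv : Tendsto (fun n : ℕ => 1 - 1 / (⌊α * (n : ℝ)⌋₊ : ℝ)) atTop (𝓝 1) := by
    simpa using (tendsto_one_div_atTop_nhds_zero_nat.comp hq).const_sub (1 : ℝ)
  have hfac : Tendsto (fun n : ℕ => (⌊α * (n : ℝ)⌋₊ : ℝ) * moveProb ⌊α * (n : ℝ)⌋₊) atTop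
      (𝓝 1) := by
    refine hinv.congr' ?_
    filter_upwards [hq.eventually_ne_atTop 0] with n hn
    have hn' : (⌊α * (n : ℝ)⌋₊ : ℝ) ≠ 0 := by exact_mod_cast hn
    rw [moveProb]
    field_simp
  have hrate : Tendsto (fun n : ℕ => (n : ℝ) * (2 * moveProb ⌊α * (n : ℝ)⌋₊)) atTop
      (𝓝 (2 / α)) := by
    have h := ((hdiv.inv₀ hα.ne').mul hfac).const_mul 2
    rw [mul_one, ← div_eq_mul_inv] at h
    refine h.congr' ?_
    filter_upwards [hq.eventually_ne_atTop 0] with n hn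
    have hn' : (⌊α * (n : ℝ)⌋₊ : ℝ) ≠ 0 := by exact_mod_cast hn
    field_simp
  have hlim := hfac.mul ((tendsto_moveProb_integral hrate).const_mul (1 / Real.pi))
  rw [← DeltaAlpha_eq_integral, one_mul] at hlim
  filter_upwards [hlim.eventually_const_lt hμ] with n hn
  exact (mul_le_mul_of_nonneg_left hn.le n.cast_nonneg).trans (le_walkMean_halfNorm _ n)

/-- Lower tail bound for the distance of two independent multinomial vectors. -/
theorem sum_sum_multWeight_close_le {q n : ℕ} (hq : q ≠ 0) {δ s r : ℝ} (hs : 0 ≤ s)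
    (hr : r ≤ δ * n) (hmean : n * (δ + s) ≤ walkMean (basisDiff q) n halfNorm) :
    ∑ x ∈ simplex q n, ∑ y ∈ simplex q n,
        (if r ≤ (∑ k, |(x k : ℝ) - (y k : ℝ)|) / 2 then 0 else 1) *
          (multWeight q n x * multWeight q n y) ≤ Real.exp (-(n * (s ^ 2 / 2))) := by
  have : NeZero q := ⟨hq⟩
  have hpt : ∀ x y : Fin q → ℕ,
      (if r ≤ (∑ k, |(x k : ℝ) - (y k : ℝ)|) / 2 then (0 : ℝ) else 1) ≤
      Real.exp (s * (δ * n)) * Real.exp (-s * halfNorm fun i => (x i : ℤ) - y i) := by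
    intro x y
    have h : halfNorm (fun i => (x i : ℤ) - y i) = (∑ k, |(x k : ℝ) - (y k : ℝ)|) / 2 := by
      simp [halfNorm]
    rw [h, ← Real.exp_add]
    split_ifs with hd
    · positivity
    · refine Real.one_le_exp ?_
      nlinarith
  calc _ ≤ ∑ x ∈ simplex q n, ∑ y ∈ simplex q n, Real.exp (s * (δ * n)) *
        (multWeight q n x * multWeight q n y *
          Real.exp (-s * halfNorm fun i => (x i : ℤ) - y i)) := by
        refine Finset.sum_le_sum fun x _ => Finset.sum_le_sum fun y _ => ?_
        calc _ ≤ _ := mul_le_mul_of_nonneg_right (hpt x y)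
              (mul_nonneg (multWeight_nonneg _ _ _) (multWeight_nonneg _ _ _))
          _ = _ := by ring
    _ = Real.exp (s * (δ * n)) *
        walkMean (basisDiff q) n fun a => Real.exp (-s * halfNorm a) := by
        simp only [← Finset.mul_sum]
        rw [sum_sum_multWeight hq n fun a => Real.exp (-s * halfNorm a)]
    _ ≤ Real.exp (s * (δ * n)) * (Real.exp (n * ((-s) ^ 2 / 2)) *
        Real.exp (-s * walkMean (basisDiff q) n halfNorm)) := by
        gcongr
        exact walkMean_exp_le _ _ _ halfNorm_add_basisDiff_sub_le _
    _ ≤ _ := by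
        rw [← Real.exp_add, ← Real.exp_add, Real.exp_le_exp]
        nlinarith

/-- Multinomial random ℓ1 codes are asymptotically good: if `L N ≤ 2^{N (R_M(δ,α) - ε)}`
eventually, then the probability (under `L N` i.i.d. `Multinomial(⌊αN⌋,N)` points of the
simplex `S_{⌊αN⌋,N}`) that all pairwise ℓ1-distances are at least `⌊δN⌋` tends to `1`. -/
theorem multinomial_random_ell1_codes_good (α δ ε : ℝ)
    (hα : 0 < α) (hδ0 : 0 < δ) (hδ1 : δ < DeltaAlpha α) (hε : 0 < ε)
    (L : ℕ → ℕ) (hLpos : ∀ N, 0 < L N)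
    (hLgrowth : ∀ᶠ N in Filter.atTop, (L N : ℝ) ≤ (2 : ℝ) ^ ((N : ℝ) * (RM δ α - ε))) :
    Filter.Tendsto
      (fun N : ℕ =>
        ∑ f ∈ Fintype.piFinset fun _ : Fin (L N) => simplex ⌊α * (N : ℝ)⌋₊ N,
          if ∀ i j : Fin (L N), i ≠ j →
              ((⌊δ * (N : ℝ)⌋₊ : ℝ)) ≤ (∑ k, |(f i k : ℝ) - (f j k : ℝ)|) / 2 then
            ∏ i, multWeight ⌊α * (N : ℝ)⌋₊ N (f i)
          else 0)
      Filter.atTop (nhds 1) := by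
  have : 0 < DeltaAlpha α - δ := by linarith
  set s := 3 / 4 * (DeltaAlpha α - δ) with hs
  have hlog : 0 < Real.log 2 := Real.log_pos one_lt_two
  have hdecay : Filter.Tendsto (fun N : ℕ => 1 - Real.exp (-(2 * ε * Real.log 2 * N)))
      Filter.atTop (nhds 1) := by
    have h : Filter.Tendsto (fun N : ℕ => 2 * ε * Real.log 2 * N) Filter.atTop Filter.atTop :=
      tendsto_natCast_atTop_atTop.const_mul_atTop (by positivity)
    simpa using (Real.tendsto_exp_neg_atTop_nhds_zero.comp h).const_sub 1
  have hq : Filter.Tendsto (fun N : ℕ => ⌊α * (N : ℝ)⌋₊) Filter.atTop Filter.atTop :=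
    tendsto_nat_floor_atTop.comp (tendsto_natCast_atTop_atTop.const_mul_atTop hα)
  refine tendsto_of_tendsto_of_tendsto_of_le_of_le' hdecay tendsto_const_nhds ?_ ?_
  · filter_upwards [hLgrowth, hq.eventually_ne_atTop 0,
      eventually_mul_le_walkMean (μ := δ + s) hα (by linarith)] with N hL hqN hmean
    have hclose := sum_sum_multWeight_close_le hqN (by positivity : 0 ≤ s)
      (Nat.floor_le (by positivity)) hmean
    have hunion := one_sub_le_sum_piFinset (ι := Fin (L N)) (multWeight_nonneg _ N)
      (sum_multWeight hqN N)
      (fun x y => (⌊δ * (N : ℝ)⌋₊ : ℝ) ≤ (∑ k, |(x k : ℝ) - (y k : ℝ)|) / 2)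
      (Real.exp_nonneg _) (le_of_eq_of_le (by congr!) hclose)
    refine le_trans ?_ (hunion.trans_eq (by congr!))
    gcongr
    rw [Fintype.card_fin]
    calc (L N : ℝ) ^ 2 * Real.exp (-(N * (s ^ 2 / 2)))
        ≤ ((2 : ℝ) ^ ((N : ℝ) * (RM δ α - ε))) ^ 2 * Real.exp (-(N * (s ^ 2 / 2))) := by
          gcongr
      _ = Real.exp (2 * (Real.log 2 * (N * (RM δ α - ε))) - N * (s ^ 2 / 2)) := by
          rw [Real.rpow_def_of_pos two_pos, ← Real.exp_nat_mul, ← Real.exp_add]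
          push_cast
          ring_nf
      _ ≤ _ := by
          rw [Real.exp_le_exp]
          have hR : Real.log 2 * RM δ α = (DeltaAlpha α - δ) ^ 2 / 8 := by
            rw [RM]
            field_simp
          have hN : 0 ≤ (N : ℝ) * (DeltaAlpha α - δ) ^ 2 := by positivity
          rw [hs]
          linear_combination 2 * N * hR + hN / 32
  · filter_upwards [hq.eventually_ne_atTop 0] with N hqN
    rw [← sum_piFinset_prod (ι := Fin (L N)) (sum_multWeight hqN N)]
    refine Finset.sum_le_sum fun f _ => ?_
    split_ifs
    · exact le_rfl
    · exact Finset.prod_nonneg fun _ _ => multWeight_nonneg _ _ _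
end

section
/- Expected normalized ℓ1-distance between two independent multinomial vectors: Fix α > 0. For each integer N ≥ 1, let X^{(N)} and Z^{(N)} be independent random vectors in S_{⌊αN⌋,N}, each distributed according to Multinomial(⌊αN⌋, N). Then lim_{N→∞} (1/N)·E[(1/2)∑_{i} |X^{(N)}_i − Z^{(N)}_i|] = e^{−2/α}·(I₀(2/α) + I₁(2/α)). -/
open scoped BigOperators

open Polynomial in
/-- The kernel `U_k(cos θ) (1 + cos θ)` integrates to `π` over `[0, π]`
for every natural number `k`. -/
lemma integral_chebyshevU_mul_one_add_cos (k : ℕ) :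
    ∫ θ in (0 : ℝ)..Real.pi,
      (Chebyshev.U ℝ (k : ℤ)).eval (Real.cos θ) * (1 + Real.cos θ) = Real.pi := by
  have integral_cos_mul (m : ℕ) (hm : m ≠ 0) :
      ∫ θ in (0 : ℝ)..Real.pi, Real.cos (m * θ) = 0 := by
    rw [intervalIntegral.integral_comp_mul_left (fun x => Real.cos x) (by exact_mod_cast hm)]
    simp [Real.sin_nat_mul_pi]
  induction k with
  | zero =>
    simp [intervalIntegral.integral_add]
  | succ k ih =>
    have h (θ : ℝ) : (Chebyshev.U ℝ ((k + 1 : ℕ) : ℤ)).eval (Real.cos θ) * (1 + Real.cos θ) =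
        (Chebyshev.U ℝ (k : ℤ)).eval (Real.cos θ) * (1 + Real.cos θ) +
          (Real.cos ((k + 2 : ℕ) * θ) + Real.cos ((k + 1 : ℕ) * θ)) := by
      have h₁ := Chebyshev.T_real_cos θ ((k + 2 : ℕ) : ℤ)
      have h₂ := Chebyshev.T_real_cos θ ((k + 1 : ℕ) : ℤ)
      rw [Int.cast_natCast] at h₁ h₂
      rw [← h₁, ← h₂]
      have h₃ := congrArg (eval (Real.cos θ)) (Chebyshev.T_eq_X_mul_U_sub_U ℝ (k : ℤ))
      have h₄ := congrArg (eval (Real.cos θ)) (Chebyshev.T_eq_U_sub_X_mul_U ℝ ((k : ℤ) + 1))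
      simp only [add_sub_cancel_right, eval_sub, eval_mul, eval_X] at h₃ h₄
      push_cast
      rw [h₃, h₄]
      ring
    simp_rw [h]
    rw [intervalIntegral.integral_add, intervalIntegral.integral_add, ih,
      integral_cos_mul _ (by simp), integral_cos_mul _ (by simp)]
    · simp
    all_goals exact Continuous.intervalIntegrable (by fun_prop) _ _

open Polynomial in
lemma integral_mul_chebyshevU_mul_one_add_cos (k : ℤ) :
    ∫ θ in (0 : ℝ)..Real.pi,
      (k : ℝ) * (Chebyshev.U ℝ (k - 1)).eval (Real.cos θ) * (1 + Real.cos θ) =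
        Real.pi * |(k : ℝ)| := by
  have key (m : ℕ) : ∫ θ in (0 : ℝ)..Real.pi,
      (m : ℝ) * (Chebyshev.U ℝ ((m : ℤ) - 1)).eval (Real.cos θ) * (1 + Real.cos θ) =
        Real.pi * m := by
    cases m with
    | zero => simp
    | succ m =>
      simp_rw [mul_assoc]
      rw [intervalIntegral.integral_const_mul]
      simp only [Nat.cast_add, Nat.cast_one, add_sub_cancel_right]
      rw [integral_chebyshevU_mul_one_add_cos, mul_comm]
  obtain ⟨m, rfl | rfl⟩ := k.eq_nat_or_neg
  · simpa using key m
  · simpa [Chebyshev.U_neg_sub_one] using key m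

lemma sum_multWeight_mul_pow {q : ℕ} (N : ℕ) (i : Fin q) (t : ℂ) :
    ∑ x ∈ simplex q N, (multWeight q N x : ℂ) * t ^ x i = ((q - 1 + t) / q) ^ N := by
  have hs : simplex q N = Finset.piAntidiag Finset.univ N := by
    ext x
    simp [simplex, Finset.Nat.mem_antidiagonalTuple]
  have ht : ∑ j, Function.update (1 : Fin q → ℂ) i t j = q - 1 + t := by
    rw [Finset.sum_update_of_mem (Finset.mem_univ i)]
    have : 1 ≤ q := i.pos
    simp [Finset.card_sdiff, Nat.cast_sub this]
    ring
  rw [div_pow, ← ht, Finset.sum_pow_eq_sum_piAntidiag, hs, Finset.sum_div]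
  refine Finset.sum_congr rfl fun x _ => ?_
  rw [Fintype.prod_eq_single i fun j hj => by simp [hj]]
  simp [multWeight]
  ring

lemma sum_multWeight_mul_cos {q : ℕ} (N : ℕ) (i : Fin q) (θ : ℝ) :
    ∑ x ∈ simplex q N, ∑ z ∈ simplex q N, multWeight q N x * multWeight q N z *
      Real.cos (((x i : ℝ) - z i) * θ) =
    (1 - 2 * ((q : ℝ) - 1) / q ^ 2 * (1 - Real.cos θ)) ^ N := by
  have hq : (q : ℂ) ≠ 0 := by exact_mod_cast i.pos.ne'
  have h : ∑ x ∈ simplex q N, ∑ z ∈ simplex q N,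
      ((multWeight q N x * multWeight q N z : ℝ) : ℂ) *
        Complex.exp ((((x i : ℝ) - z i) * θ : ℝ) * Complex.I) =
      (((1 - 2 * ((q : ℝ) - 1) / q ^ 2 * (1 - Real.cos θ)) ^ N : ℝ) : ℂ) := by
    have h₁ := sum_multWeight_mul_pow N i (Complex.exp (θ * Complex.I))
    have h₂ := sum_multWeight_mul_pow N i (Complex.exp (-θ * Complex.I))
    have h₃ := congrArg₂ (· * ·) h₁ h₂
    simp only [Finset.sum_mul_sum, ← mul_pow] at h₃
    convert h₃ using 1
    · refine Finset.sum_congr rfl fun x _ => Finset.sum_congr rfl fun z _ => ?_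
      rw [← Complex.exp_nat_mul, ← Complex.exp_nat_mul, mul_mul_mul_comm, ← Complex.exp_add]
      push_cast
      congr 2
      ring
    · push_cast
      congr 1
      have he : Complex.exp (θ * Complex.I) * Complex.exp (-θ * Complex.I) = 1 := by
        rw [← Complex.exp_add]; simp
      rw [Complex.cos]
      simp only [neg_mul] at he ⊢
      field_simp
      linear_combination -he
  have h' := congrArg Complex.re h
  simpa [-Complex.ofReal_mul, -Complex.ofReal_sub, -Complex.ofReal_pow, Complex.exp_ofReal_mul_I_re,
    Complex.re_ofReal_mul] using h'

lemma sum_multWeight_mul_sin {q : ℕ} (N : ℕ) (i : Fin q) (θ : ℝ) :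
    ∑ x ∈ simplex q N, ∑ z ∈ simplex q N, multWeight q N x * multWeight q N z *
      (((x i : ℝ) - z i) * Real.sin (((x i : ℝ) - z i) * θ)) =
    N * (2 * ((q : ℝ) - 1) / q ^ 2) *
      (1 - 2 * ((q : ℝ) - 1) / q ^ 2 * (1 - Real.cos θ)) ^ (N - 1) * Real.sin θ := by
  have hl : HasDerivAt (fun θ : ℝ => ∑ x ∈ simplex q N, ∑ z ∈ simplex q N,
      multWeight q N x * multWeight q N z * Real.cos (((x i : ℝ) - z i) * θ))
      (∑ x ∈ simplex q N, ∑ z ∈ simplex q N, multWeight q N x * multWeight q N z *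
        (-Real.sin (((x i : ℝ) - z i) * θ) * (((x i : ℝ) - z i) * 1))) θ :=
    HasDerivAt.fun_sum fun x _ => HasDerivAt.fun_sum fun z _ =>
      (((hasDerivAt_id θ).const_mul _).cos).const_mul _
  have hr : HasDerivAt (fun θ : ℝ =>
      (1 - 2 * ((q : ℝ) - 1) / q ^ 2 * (1 - Real.cos θ)) ^ N) _ θ :=
    ((((Real.hasDerivAt_cos θ).const_sub 1).const_mul
      (2 * ((q : ℝ) - 1) / q ^ 2)).const_sub 1).fun_pow N
  simp_rw [sum_multWeight_mul_cos N i] at hl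
  have h := hl.unique hr
  rw [← neg_inj, ← Finset.sum_neg_distrib]
  simp_rw [← Finset.sum_neg_distrib]
  convert h using 1
  · refine Finset.sum_congr rfl fun x _ => Finset.sum_congr rfl fun z _ => ?_
    ring
  · ring

open Polynomial in
/-- The expected absolute difference of one coordinate of two independent multinomial vectors,
as an integral. -/
lemma sum_multWeight_mul_abs_sub {q : ℕ} (N : ℕ) (i : Fin q) :
    ∑ x ∈ simplex q N, ∑ z ∈ simplex q N, multWeight q N x * multWeight q N z *
      |(x i : ℝ) - z i| =
    N * (2 * ((q : ℝ) - 1) / q ^ 2) * (1 / Real.pi * ∫ θ in (0 : ℝ)..Real.pi,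
      (1 - 2 * ((q : ℝ) - 1) / q ^ 2 * (1 - Real.cos θ)) ^ (N - 1) * (1 + Real.cos θ)) := by
  set c : ℝ := 2 * ((q : ℝ) - 1) / q ^ 2 with hc
  have habs (x z : Fin q → ℕ) : |(x i : ℝ) - z i| = 1 / Real.pi *
      ∫ θ in (0 : ℝ)..Real.pi, ((x i : ℝ) - z i) *
        (Chebyshev.U ℝ ((x i : ℤ) - z i - 1)).eval (Real.cos θ) * (1 + Real.cos θ) := by
    have h := integral_mul_chebyshevU_mul_one_add_cos ((x i : ℤ) - z i)
    push_cast at h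
    rw [h]
    field_simp
  simp_rw [habs, mul_left_comm _ (1 / Real.pi), ← Finset.mul_sum]
  congr 1
  simp_rw [← intervalIntegral.integral_const_mul]
  have hcont (x z : Fin q → ℕ) : IntervalIntegrable (fun θ => multWeight q N x * multWeight q N z *
      (((x i : ℝ) - z i) * (Chebyshev.U ℝ ((x i : ℤ) - z i - 1)).eval (Real.cos θ) *
        (1 + Real.cos θ))) MeasureTheory.volume 0 Real.pi :=
    Continuous.intervalIntegrable (by fun_prop) _ _
  simp_rw [← intervalIntegral.integral_finsetSum fun z _ => hcont _ z]
  rw [← intervalIntegral.integral_finsetSum fun x _ =>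
    Continuous.intervalIntegrable (continuous_finsetSum _ fun z _ => by fun_prop) _ _]
  refine intervalIntegral.integral_congr_Ioo_of_le Real.pi_pos.le fun θ hθ => ?_
  refine mul_right_cancel₀ (Real.sin_pos_of_mem_Ioo hθ).ne' ?_
  have h := sum_multWeight_mul_sin N i θ
  rw [← hc] at h
  rw [show N * c * ((1 - c * (1 - Real.cos θ)) ^ (N - 1) * (1 + Real.cos θ)) * Real.sin θ =
    N * c * (1 - c * (1 - Real.cos θ)) ^ (N - 1) * Real.sin θ * (1 + Real.cos θ) by ring, ← h]
  simp_rw [Finset.sum_mul]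
  refine Finset.sum_congr rfl fun x _ => Finset.sum_congr rfl fun z _ => ?_
  have hU := Chebyshev.U_real_cos θ ((x i : ℤ) - z i - 1)
  push_cast at hU
  rw [sub_add_cancel] at hU
  rw [← hU]
  ring

lemma expected_distance_eq_integral {q N : ℕ} (hq : 0 < q) (hN : 0 < N) :
    (1 / (N : ℝ)) * ∑ x ∈ simplex q N, ∑ z ∈ simplex q N,
      multWeight q N x * multWeight q N z * ((∑ i, |(x i : ℝ) - (z i : ℝ)|) / 2) =
    (1 - 1 / (q : ℝ)) * (1 / Real.pi * ∫ θ in (0 : ℝ)..Real.pi,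
      (1 - 2 * ((q : ℝ) - 1) / q ^ 2 * (1 - Real.cos θ)) ^ (N - 1) * (1 + Real.cos θ)) := by
  have h : ∑ x ∈ simplex q N, ∑ z ∈ simplex q N,
      multWeight q N x * multWeight q N z * ((∑ i, |(x i : ℝ) - (z i : ℝ)|) / 2) =
      (∑ i : Fin q, ∑ x ∈ simplex q N, ∑ z ∈ simplex q N,
        multWeight q N x * multWeight q N z * |(x i : ℝ) - (z i : ℝ)|) / 2 := by
    simp only [Finset.sum_div, Finset.mul_sum, mul_div_assoc]
    symm
    rw [Finset.sum_comm]
    refine Finset.sum_congr rfl fun x _ => ?_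
    rw [Finset.sum_comm]
  rw [h]
  simp_rw [sum_multWeight_mul_abs_sub]
  rw [Finset.sum_const, Finset.card_univ, Fintype.card_fin, nsmul_eq_mul]
  generalize (1 / Real.pi * ∫ θ in (0 : ℝ)..Real.pi, _) = J
  have : (q : ℝ) ≠ 0 := by positivity
  have : (N : ℝ) ≠ 0 := by positivity
  field_simp

lemma exp_mul_besselI_zero_add_one (x : ℝ) :
    Real.exp (-x) * (besselI 0 x + besselI 1 x) =
      1 / Real.pi * ∫ θ in (0 : ℝ)..Real.pi,
        Real.exp (-(x * (1 - Real.cos θ))) * (1 + Real.cos θ) := by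
  rw [besselI, besselI, ← mul_add, mul_left_comm, ← intervalIntegral.integral_add,
    ← intervalIntegral.integral_const_mul]
  · congr 2 with θ
    rw [show -(x * (1 - Real.cos θ)) = -x + x * Real.cos θ by ring, Real.exp_add]
    simp
    ring
  all_goals exact Continuous.intervalIntegrable (by fun_prop) _ _

/-- Dominated convergence: `(1 - cₙ(1 - cos θ))ⁿ` converges to `exp (-x(1 - cos θ))` under the
integral when `n cₙ → x`. -/
lemma tendsto_integral_one_sub_mul_pow {c : ℕ → ℝ} {x : ℝ} (hc₀ : ∀ᶠ n in Filter.atTop, 0 ≤ c n)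
    (hc₁ : ∀ᶠ n in Filter.atTop, c n ≤ 1)
    (hc : Filter.Tendsto (fun n : ℕ => n * c n) Filter.atTop (nhds x)) :
    Filter.Tendsto (fun n : ℕ => ∫ θ in (0 : ℝ)..Real.pi,
        (1 - c n * (1 - Real.cos θ)) ^ n * (1 + Real.cos θ)) Filter.atTop
      (nhds (∫ θ in (0 : ℝ)..Real.pi,
        Real.exp (-(x * (1 - Real.cos θ))) * (1 + Real.cos θ))) := by
  refine intervalIntegral.tendsto_integral_filter_of_dominated_convergence
    (fun θ => 1 + Real.cos θ) ?_ ?_ (Continuous.intervalIntegrable (by fun_prop) _ _) ?_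
  · exact Filter.Eventually.of_forall fun n =>
      Continuous.aestronglyMeasurable (by fun_prop)
  · filter_upwards [hc₀, hc₁] with n h₀ h₁
    refine Filter.Eventually.of_forall fun θ _ => ?_
    have hl := Real.neg_one_le_cos θ
    have hu := Real.cos_le_one θ
    rw [norm_mul, norm_pow, Real.norm_eq_abs, Real.norm_eq_abs,
      abs_of_nonneg (by linarith : 0 ≤ 1 + Real.cos θ)]
    refine mul_le_of_le_one_left (by linarith) (pow_le_one₀ (abs_nonneg _) ?_)
    rw [abs_le]
    constructor <;> nlinarith
  · refine Filter.Eventually.of_forall fun θ _ => Filter.Tendsto.mul_const _ ?_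
    have h : Filter.Tendsto (fun n : ℕ => (n : ℝ) * (-(c n * (1 - Real.cos θ)))) Filter.atTop
        (nhds (-(x * (1 - Real.cos θ)))) := by
      refine (hc.mul_const (1 - Real.cos θ)).neg.congr fun n => ?_
      ring
    simpa [sub_eq_add_neg] using Real.tendsto_one_add_pow_exp_of_tendsto h

/-- The expected normalized ℓ1-distance between two independent
`Multinomial(⌊αN⌋, N)` vectors converges to `e^{-2/α} (I₀(2/α) + I₁(2/α))`. -/
theorem expected_multinomial_distance (α : ℝ) (hα : 0 < α) :
    Filter.Tendsto
      (fun N : ℕ =>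
        (1 / (N : ℝ)) *
          ∑ x ∈ simplex ⌊α * (N : ℝ)⌋₊ N, ∑ z ∈ simplex ⌊α * (N : ℝ)⌋₊ N,
            multWeight ⌊α * (N : ℝ)⌋₊ N x * multWeight ⌊α * (N : ℝ)⌋₊ N z *
              ((∑ i, |(x i : ℝ) - (z i : ℝ)|) / 2))
      Filter.atTop
      (nhds (Real.exp (-2 / α) * (besselI 0 (2 / α) + besselI 1 (2 / α)))) := by
  have hq : Filter.Tendsto (fun N : ℕ => ⌊α * ((N + 1 : ℕ) : ℝ)⌋₊) Filter.atTop Filter.atTop :=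
    tendsto_nat_floor_atTop.comp ((tendsto_natCast_atTop_atTop.const_mul_atTop hα).comp
      (Filter.tendsto_add_atTop_nat 1))
  have hinv : Filter.Tendsto (fun N : ℕ => 1 / (⌊α * ((N + 1 : ℕ) : ℝ)⌋₊ : ℝ)) Filter.atTop
      (nhds 0) := tendsto_one_div_atTop_nhds_zero_nat.comp hq
  have hratio : Filter.Tendsto (fun N : ℕ => ((N + 1 : ℕ) : ℝ) / ⌊α * ((N + 1 : ℕ) : ℝ)⌋₊)
      Filter.atTop (nhds α⁻¹) := by
    have h := ((tendsto_nat_floor_mul_div_atTop hα.le).comp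
      (tendsto_natCast_atTop_atTop (R := ℝ))).comp (Filter.tendsto_add_atTop_nat 1)
    exact (h.inv₀ hα.ne').congr fun N => by simp
  rw [← Filter.tendsto_add_atTop_iff_nat 1, neg_div, exp_mul_besselI_zero_add_one,
    ← one_mul (1 / Real.pi * _)]
  have hone : Filter.Tendsto (fun N : ℕ => 1 - 1 / (⌊α * ((N + 1 : ℕ) : ℝ)⌋₊ : ℝ)) Filter.atTop
      (nhds 1) := by simpa using hinv.const_sub 1
  have hlim := tendsto_integral_one_sub_mul_pow (x := 2 / α)
    (c := fun N => 2 * ((⌊α * ((N + 1 : ℕ) : ℝ)⌋₊ : ℝ) - 1) / (⌊α * ((N + 1 : ℕ) : ℝ)⌋₊ : ℝ) ^ 2)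
    ?_ ?_ ?_
  · refine (hone.mul (hlim.const_mul (1 / Real.pi))).congr' ?_
    filter_upwards [hq.eventually_gt_atTop 0] with N hN
    rw [expected_distance_eq_integral hN N.succ_pos, Nat.succ_sub_one]
  · filter_upwards [hq.eventually_ge_atTop 1] with N hN
    have : (1 : ℝ) ≤ ⌊α * ((N + 1 : ℕ) : ℝ)⌋₊ := by exact_mod_cast hN
    exact div_nonneg (by linarith) (by positivity)
  · filter_upwards [hq.eventually_gt_atTop 0] with N hN
    rw [div_le_one (by positivity)]
    nlinarith [sq_nonneg ((⌊α * ((N + 1 : ℕ) : ℝ)⌋₊ : ℝ) - 1)]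
  · have h := ((hratio.sub hinv).const_mul 2).mul hone
    rw [sub_zero, mul_one, ← div_eq_mul_inv] at h
    refine h.congr' ?_
    filter_upwards [hq.eventually_gt_atTop 0] with N hN
    generalize ⌊α * ((N + 1 : ℕ) : ℝ)⌋₊ = q at hN ⊢
    have : (q : ℝ) ≠ 0 := by positivity
    push_cast
    field_simp
    ring
end
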